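/- arXiv:1903.02701 — 9 statements merged into one kernel-verified Lean document; each statement's English description precedes it below -/
import Mathlib

section
/- Let n ≥ 1 and let R be an algebraic Kähler curvature tensor on ℂ^n. Then CQB₁ ≥ 0 holds if and only if for all vectors x, y : Fin n → ℂ one has ‖x‖² · Ric(y,ȳ) − R(x,x̄,y,ȳ) ≥ 0. Moreover, if CQB₁ > 0 then ‖x‖² · Ric(y,ȳ) − R(x,x̄,y,ȳ) > 0 whenever x and y are both nonzero. (Corollary 2.5 of the paper, pointwise/algebraic form.) -/
open Finset

/-- An algebraic Kähler curvature tensor on ℂ^n: Kähler symmetries and reality. -/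
noncomputable def IsKahlerCurv {n : ℕ} (R : Fin n → Fin n → Fin n → Fin n → ℂ) : Prop :=
  (∀ a b c d, R a b c d = R c b a d) ∧
  (∀ a b c d, R a b c d = R a d c b) ∧
  (∀ a b c d, star (R a b c d) = R b a d c)

/-- The Ricci tensor `Ric a b = ∑ c, R a b c c`. -/
noncomputable def ricT {n : ℕ} (R : Fin n → Fin n → Fin n → Fin n → ℂ) (a b : Fin n) : ℂ :=
  ∑ c, R a b c c

/-- `Ric(x, ȳ)`. -/
noncomputable def ricForm {n : ℕ} (R : Fin n → Fin n → Fin n → Fin n → ℂ) (x y : Fin n → ℂ) : ℂ :=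
  ∑ a, ∑ b, ricT R a b * x a * star (y b)

/-- The bisectional curvature `R(x, x̄, y, ȳ)`. -/
noncomputable def bisec {n : ℕ} (R : Fin n → Fin n → Fin n → Fin n → ℂ) (x y : Fin n → ℂ) : ℂ :=
  ∑ a, ∑ b, ∑ c, ∑ d, R a b c d * x a * star (x b) * y c * star (y d)

/-- `‖x‖²`. -/
noncomputable def norm2 {n : ℕ} (x : Fin n → ℂ) : ℝ := ∑ a, ‖x a‖ ^ 2

/-- The cross quadratic bisectional curvature quadratic form on matrices. -/
noncomputable def CQB {n : ℕ} (R : Fin n → Fin n → Fin n → Fin n → ℂ)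
    (A : Matrix (Fin n) (Fin n) ℂ) : ℝ :=
  ((∑ a, ∑ b, ∑ c, ricT R a b * A c a * star (A c b)) -
    (∑ a, ∑ b, ∑ c, ∑ d, R a b c d * A a c * star (A b d))).re

/-- A matrix over a field of rank at most one is an outer product. -/
theorem Matrix.exists_eq_vecMulVec_of_rank_le_one {m n K : Type*} [Fintype m] [Fintype n] [Field K]
    {A : Matrix m n K} (h : A.rank ≤ 1) : ∃ w v, A = Matrix.vecMulVec w v := by
  classical
  obtain ⟨⟨w, _⟩, hw⟩ := finrank_le_one_iff.mp h
  choose c hc using fun j => hw ⟨A.mulVecLin (Pi.single j 1), LinearMap.mem_range_self _ _⟩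
  refine ⟨w, c, ?_⟩
  ext i j
  have hij := congrFun (congrArg Subtype.val (hc j)) i
  simp only [Submodule.coe_smul, Pi.smul_apply, smul_eq_mul, Matrix.mulVecLin_apply,
    Matrix.mulVec_single_one, Matrix.col_apply] at hij
  rw [Matrix.vecMulVec_apply, mul_comm, hij]

/-- On the outer product `x yᵀ`, the form `CQB` is `‖x‖² Ric(y, ȳ) - R(x, x̄, y, ȳ)`. -/
theorem CQB_vecMulVec {n : ℕ} (R : Fin n → Fin n → Fin n → Fin n → ℂ) (x y : Fin n → ℂ) :
    CQB R (Matrix.vecMulVec x y) = norm2 x * (ricForm R y y).re - (bisec R x y).re := by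
  have hnorm : (norm2 x : ℂ) = ∑ c, x c * star (x c) := by
    simp [norm2, Complex.mul_conj']
  have hric : (∑ a, ∑ b, ∑ c, ricT R a b * Matrix.vecMulVec x y c a *
      star (Matrix.vecMulVec x y c b)) = norm2 x * ricForm R y y := by
    simp only [hnorm, ricForm, Finset.mul_sum, Finset.sum_mul, Matrix.vecMulVec_apply, star_mul']
    refine sum_congr rfl fun a _ => sum_congr rfl fun b _ => sum_congr rfl fun c _ => ?_
    ring
  have hbisec : (∑ a, ∑ b, ∑ c, ∑ d, R a b c d * Matrix.vecMulVec x y a c *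
      star (Matrix.vecMulVec x y b d)) = bisec R x y := by
    simp only [bisec, Matrix.vecMulVec_apply, star_mul']
    refine sum_congr rfl fun a _ => sum_congr rfl fun b _ => sum_congr rfl fun c _ =>
      sum_congr rfl fun d _ => ?_
    ring
  rw [CQB, hric, hbisec, Complex.sub_re, Complex.re_ofReal_mul]

/-- Corollary 2.5: `CQB₁ ≥ 0` iff `‖x‖²·Ric(y,ȳ) − R(x,x̄,y,ȳ) ≥ 0` for all `x, y`;
and if `CQB₁ > 0` then the strict inequality holds for nonzero `x, y`. -/
theorem cqb_one_nonneg_iff (n : ℕ) (hn : 1 ≤ n)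
    (R : Fin n → Fin n → Fin n → Fin n → ℂ) (hR : IsKahlerCurv R) :
    ((∀ A : Matrix (Fin n) (Fin n) ℂ, A.rank ≤ 1 → 0 ≤ CQB R A) ↔
      (∀ x y : Fin n → ℂ, 0 ≤ norm2 x * (ricForm R y y).re - (bisec R x y).re)) ∧
    ((∀ A : Matrix (Fin n) (Fin n) ℂ, A ≠ 0 → A.rank ≤ 1 → 0 < CQB R A) →
      (∀ x y : Fin n → ℂ, x ≠ 0 → y ≠ 0 →
        0 < norm2 x * (ricForm R y y).re - (bisec R x y).re)) := by
  refine ⟨⟨fun h x y => ?_, fun h A hA => ?_⟩, fun h x y hx hy => ?_⟩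
  · rw [← CQB_vecMulVec]
    exact h _ (Matrix.rank_vecMulVec_le x y)
  · obtain ⟨x, y, rfl⟩ := Matrix.exists_eq_vecMulVec_of_rank_le_one hA
    rw [CQB_vecMulVec]
    exact h x y
  · rw [← CQB_vecMulVec]
    exact h _ (Matrix.vecMulVec_ne_zero hx hy) (Matrix.rank_vecMulVec_le x y)
end

section
/- Let n ≥ 1 and let R be an algebraic Kähler curvature tensor on ℂ^n with ᵈCQB₁ ≥ 0. Then for every x : Fin n → ℂ one has (n+1) · ‖x‖² · Ric(x,x̄) ≥ ‖x‖² · Ric(x,x̄) + R(x,x̄,x,x̄) ≥ 0; in particular Ric(x,x̄) ≥ 0 for every x (the Ricci curvature is positive semidefinite and dominates 1/(n+1) times Ric⁺). If moreover ᵈCQB₁ > 0, then Ric(x,x̄) > 0 for every nonzero x. (Part of Theorem 2.6 of the paper, pointwise/algebraic form.) -/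
open Finset

/-- The dual cross quadratic bisectional curvature quadratic form on matrices. -/
noncomputable def dCQB {n : ℕ} (R : Fin n → Fin n → Fin n → Fin n → ℂ)
    (A : Matrix (Fin n) (Fin n) ℂ) : ℝ :=
  ((∑ a, ∑ c, ∑ d, ricT R c d * star (A c a) * A d a) +
    (∑ a, ∑ b, ∑ c, ∑ d, R a b c d * star (A c a) * A d b)).re

theorem ofReal_norm2 {n : ℕ} (x : Fin n → ℂ) : (norm2 x : ℂ) = ∑ a, x a * star (x a) := by
  simp [norm2, Complex.mul_conj, Complex.normSq_eq_norm_sq]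

theorem norm2_nonneg {n : ℕ} (x : Fin n → ℂ) : 0 ≤ norm2 x :=
  Finset.sum_nonneg fun _ _ => by positivity

theorem norm2_eq_zero_iff {n : ℕ} (x : Fin n → ℂ) : norm2 x = 0 ↔ x = 0 := by
  rw [norm2, Finset.sum_eq_zero_iff_of_nonneg fun _ _ => by positivity]
  simp [funext_iff]

theorem dCQB_vecMulVec_star {n : ℕ} (R : Fin n → Fin n → Fin n → Fin n → ℂ)
    (x y : Fin n → ℂ) :
    dCQB R (Matrix.vecMulVec (star x) (star y)) =
      norm2 y * (ricForm R x x).re + (bisec R y x).re := by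
  rw [← Complex.re_ofReal_mul, ← Complex.add_re, dCQB, ofReal_norm2]
  congr 2
  · simp only [ricForm, Finset.sum_mul, Finset.mul_sum, Matrix.vecMulVec_apply, Pi.star_apply,
      star_mul', star_star]
    rw [Finset.sum_comm]
    refine Finset.sum_congr rfl fun _ _ => ?_
    rw [Finset.sum_comm]
    exact Finset.sum_congr rfl fun _ _ => Finset.sum_congr rfl fun _ _ => by ring
  · simp only [bisec, Matrix.vecMulVec_apply, Pi.star_apply, star_mul', star_star]
    exact Finset.sum_congr rfl fun _ _ => Finset.sum_congr rfl fun _ _ =>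
      Finset.sum_congr rfl fun _ _ => Finset.sum_congr rfl fun _ _ => by ring

/-- `‖x‖²` times the orthogonal projection of the `i`-th basis vector to the complement of `x`. -/
noncomputable def orthBasisProj {n : ℕ} (x : Fin n → ℂ) (i c : Fin n) : ℂ :=
  norm2 x * (if i = c then 1 else 0) - star (x i) * x c

theorem sum_orthBasisProj_mul_star {n : ℕ} (x : Fin n → ℂ) (c d : Fin n) :
    ∑ i, orthBasisProj x i c * star (orthBasisProj x i d) =
      (norm2 x : ℂ) ^ 2 * (if c = d then 1 else 0) - norm2 x * (x c * star (x d)) := by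
  have expand : ∀ i, orthBasisProj x i c * star (orthBasisProj x i d) =
      (norm2 x : ℂ) ^ 2 * ((if i = c then 1 else 0) * (if i = d then 1 else 0))
        - norm2 x * ((if i = c then 1 else 0) * (x i * star (x d)))
        - norm2 x * ((if i = d then 1 else 0) * (star (x i) * x c))
        + x i * star (x i) * (x c * star (x d)) := by
    intro i
    have real_star : star (norm2 x : ℂ) = norm2 x := Complex.conj_ofReal _
    have ite_star : star (if i = d then (1 : ℂ) else 0) = if i = d then 1 else 0 := by
      split_ifs <;> simp
    simp only [orthBasisProj, star_sub, star_mul', star_star, real_star, ite_star]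
    ring
  simp only [expand, Finset.sum_add_distrib, Finset.sum_sub_distrib, ← Finset.mul_sum,
    ← Finset.sum_mul, ← ofReal_norm2, ite_mul, one_mul, zero_mul, Finset.sum_ite_eq',
    Finset.mem_univ, if_true]
  ring

theorem sum_norm2_orthBasisProj {n : ℕ} (x : Fin n → ℂ) :
    ∑ i, norm2 (orthBasisProj x i) = (n - 1) * norm2 x ^ 2 := by
  apply Complex.ofReal_injective
  simp only [Complex.ofReal_sum, ofReal_norm2 (orthBasisProj x _)]
  rw [Finset.sum_comm]
  simp only [sum_orthBasisProj_mul_star, Finset.sum_sub_distrib, ← Finset.mul_sum,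
    ← ofReal_norm2]
  simp
  ring

theorem sum_bisec_orthBasisProj {n : ℕ} {R : Fin n → Fin n → Fin n → Fin n → ℂ}
    (hR : IsKahlerCurv R) (x : Fin n → ℂ) :
    ∑ i, bisec R (orthBasisProj x i) x =
      (norm2 x : ℂ) ^ 2 * ricForm R x x - norm2 x * bisec R x x := by
  have collect : ∑ i, bisec R (orthBasisProj x i) x = ∑ a, ∑ b, ∑ c, ∑ d,
      R a b c d * (∑ i, orthBasisProj x i a * star (orthBasisProj x i b)) *
        (x c * star (x d)) := by
    simp only [bisec]
    rw [Finset.sum_comm]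
    refine Finset.sum_congr rfl fun a _ => ?_
    rw [Finset.sum_comm]
    refine Finset.sum_congr rfl fun b _ => ?_
    rw [Finset.sum_comm]
    refine Finset.sum_congr rfl fun c _ => ?_
    rw [Finset.sum_comm]
    refine Finset.sum_congr rfl fun d _ => ?_
    rw [Finset.mul_sum, Finset.sum_mul]
    exact Finset.sum_congr rfl fun i _ => by ring
  have ric : ricForm R x x = ∑ a, ∑ b, ∑ c, ∑ d,
      R a b c d * (if a = b then 1 else 0) * (x c * star (x d)) := by
    have diag : ∀ a, ∑ b, ∑ c, ∑ d,
        R a b c d * (if a = b then 1 else 0) * (x c * star (x d)) =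
          ∑ c, ∑ d, R c d a a * (x c * star (x d)) := by
      intro a
      rw [Finset.sum_eq_single a (fun b _ hb => by simp [hb.symm]) (by simp)]
      refine Finset.sum_congr rfl fun c _ => Finset.sum_congr rfl fun d _ => ?_
      rw [hR.1 a a c d, hR.2.1 c a a d]
      simp
    simp only [diag]
    rw [Finset.sum_comm]
    refine Finset.sum_congr rfl fun c _ => ?_
    rw [Finset.sum_comm]
    refine Finset.sum_congr rfl fun d _ => ?_
    rw [ricT, Finset.sum_mul, Finset.sum_mul]
    exact Finset.sum_congr rfl fun a _ => by ring
  rw [collect, ric]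
  simp only [bisec, sum_orthBasisProj_mul_star, Finset.mul_sum, ← Finset.sum_sub_distrib]
  exact Finset.sum_congr rfl fun _ _ => Finset.sum_congr rfl fun _ _ =>
    Finset.sum_congr rfl fun _ _ => Finset.sum_congr rfl fun _ _ => by ring

/-- The holomorphic sectional curvature is bounded by the Ricci curvature. -/
theorem bisec_self_le_of_dCQB_nonneg {n : ℕ} {R : Fin n → Fin n → Fin n → Fin n → ℂ}
    (hR : IsKahlerCurv R)
    (hdCQB : ∀ A : Matrix (Fin n) (Fin n) ℂ, A.rank ≤ 1 → 0 ≤ dCQB R A) (x : Fin n → ℂ) :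
    (bisec R x x).re ≤ n * norm2 x * (ricForm R x x).re := by
  rcases (norm2_nonneg x).eq_or_lt with h_zero | h_pos
  · obtain rfl := (norm2_eq_zero_iff x).1 h_zero.symm
    simp [bisec, ricForm]
  have total : 0 ≤ ∑ i, (norm2 (orthBasisProj x i) * (ricForm R x x).re +
      (bisec R (orthBasisProj x i) x).re) :=
    Finset.sum_nonneg fun i _ => by
      rw [← dCQB_vecMulVec_star]
      exact hdCQB _ (Matrix.rank_vecMulVec_le _ _)
  rw [Finset.sum_add_distrib, ← Finset.sum_mul, sum_norm2_orthBasisProj, ← Complex.re_sum,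
    sum_bisec_orthBasisProj hR, Complex.sub_re, ← Complex.ofReal_pow, Complex.re_ofReal_mul,
    Complex.re_ofReal_mul] at total
  refine le_of_mul_le_mul_left ?_ h_pos
  linarith

/-- Theorem 2.6 (part): if `ᵈCQB₁ ≥ 0` then
`(n+1)·‖x‖²·Ric(x,x̄) ≥ ‖x‖²·Ric(x,x̄) + R(x,x̄,x,x̄) ≥ 0`, in particular `Ric ≥ 0`;
and if `ᵈCQB₁ > 0` then `Ric > 0` on nonzero vectors. -/
theorem ric_nonneg_of_dcqb_one_nonneg (n : ℕ) (hn : 1 ≤ n)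
    (R : Fin n → Fin n → Fin n → Fin n → ℂ) (hR : IsKahlerCurv R)
    (hdCQB : ∀ A : Matrix (Fin n) (Fin n) ℂ, A.rank ≤ 1 → 0 ≤ dCQB R A) :
    (∀ x : Fin n → ℂ,
      ((n : ℝ) + 1) * norm2 x * (ricForm R x x).re ≥
        norm2 x * (ricForm R x x).re + (bisec R x x).re ∧
      norm2 x * (ricForm R x x).re + (bisec R x x).re ≥ 0 ∧
      0 ≤ (ricForm R x x).re) ∧
    ((∀ A : Matrix (Fin n) (Fin n) ℂ, A ≠ 0 → A.rank ≤ 1 → 0 < dCQB R A) →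
      ∀ x : Fin n → ℂ, x ≠ 0 → 0 < (ricForm R x x).re) := by
  have upper := bisec_self_le_of_dCQB_nonneg hR hdCQB
  have lower : ∀ x, 0 ≤ norm2 x * (ricForm R x x).re + (bisec R x x).re := fun x => by
    rw [← dCQB_vecMulVec_star]
    exact hdCQB _ (Matrix.rank_vecMulVec_le _ _)
  refine ⟨fun x => ⟨by linarith [upper x], lower x, ?_⟩, fun h_strict x hx => ?_⟩
  · rcases (norm2_nonneg x).eq_or_lt with h_zero | h_pos
    · obtain rfl := (norm2_eq_zero_iff x).1 h_zero.symm
      simp [ricForm]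
    · refine nonneg_of_mul_nonneg_right (a := ((n : ℝ) + 1) * norm2 x) ?_ (by positivity)
      linarith [upper x, lower x]
  · have h_outer : Matrix.vecMulVec (star x) (star x) ≠ 0 := by
      simpa [Matrix.vecMulVec_eq_zero] using hx
    have h_lower := h_strict _ h_outer (Matrix.rank_vecMulVec_le _ _)
    rw [dCQB_vecMulVec_star] at h_lower
    refine pos_of_mul_pos_right (a := ((n : ℝ) + 1) * norm2 x) ?_
      (mul_nonneg (by positivity) (norm2_nonneg x))
    linarith [upper x]
end

section
/- Let n ≥ 2 and let R be an algebraic Kähler curvature tensor on ℂ^n with CQB₁ ≥ 0. If x : Fin n → ℂ satisfies Ric(x,x̄) = 0, then x lies in the kernel of the curvature tensor: for all y, z, w : Fin n → ℂ one has ∑_{a,b,c,d} R a b c d · x a · conj (y b) · z c · conj (w d) = 0. (The remark following Corollary 2.5, used in the proof of Theorem 3.1.) -/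
open Finset

open scoped Matrix ComplexOrder

/-- A complex matrix whose quadratic form vanishes identically is zero. -/
theorem Matrix.eq_zero_of_forall_star_dotProduct_mulVec {ι : Type*} [Fintype ι]
    (T : Matrix ι ι ℂ) (h : ∀ u : ι → ℂ, star u ⬝ᵥ T *ᵥ u = 0) : T = 0 := by
  classical
  have hT : Matrix.toEuclideanLin T = 0 := by
    refine (inner_map_self_eq_zero _).mp fun u => ?_
    rw [← inner_conj_symm, EuclideanSpace.inner_eq_star_dotProduct,
      Matrix.ofLp_toLpLin, Matrix.toLin'_apply, dotProduct_comm, h, map_zero]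
  simpa using hT

namespace IsKahlerCurv

variable {n : ℕ} {R : Fin n → Fin n → Fin n → Fin n → ℂ}

variable (R) in
/-- The matrix of the Hermitian form `Ric`. -/
noncomputable def ricMatrix : Matrix (Fin n) (Fin n) ℂ := Matrix.of fun b a => ricT R a b

variable (R) in
/-- The matrix of the Hermitian form `v ↦ R(u, ū, v, v̄)`. -/
noncomputable def curvMatrix (u : Fin n → ℂ) : Matrix (Fin n) (Fin n) ℂ :=
  Matrix.of fun d c => ∑ a, ∑ b, R a b c d * u a * star (u b)

variable (R) in
/-- The matrix of the Hermitian form `v ↦ ‖u‖² Ric(v, v̄) - R(u, ū, v, v̄)`. -/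
noncomputable def cqbMatrix (u : Fin n → ℂ) : Matrix (Fin n) (Fin n) ℂ :=
  (star u ⬝ᵥ u) • ricMatrix R - curvMatrix R u

theorem apply_swap_pairs (hR : IsKahlerCurv R) (a b c d : Fin n) : R a b c d = R c d a b := by
  rw [hR.1, hR.2.1]

theorem star_dotProduct_ricMatrix_mulVec (v : Fin n → ℂ) :
    star v ⬝ᵥ ricMatrix R *ᵥ v = ricForm R v v := by
  simp only [dotProduct, Matrix.mulVec, ricMatrix, ricForm, Matrix.of_apply, Pi.star_apply,
    Finset.mul_sum]
  rw [Finset.sum_comm]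
  exact sum_congr rfl fun _ _ => sum_congr rfl fun _ _ => by ring

theorem star_dotProduct_curvMatrix_mulVec (u v : Fin n → ℂ) :
    star v ⬝ᵥ curvMatrix R u *ᵥ v = bisec R u v := by
  have h : ∀ F : Fin n → Fin n → Fin n → Fin n → ℂ,
      ∑ d, ∑ c, ∑ a, ∑ b, F a b c d = ∑ a, ∑ b, ∑ c, ∑ d, F a b c d := fun F => by
    simp only [← Finset.sum_product']
    exact Finset.sum_bij' (fun p _ => (p.2.2.1, p.2.2.2, p.2.1, p.1))
      (fun p _ => (p.2.2.2, p.2.2.1, p.1, p.2.1)) (by simp) (by simp) (by simp) (by simp)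
      (by simp)
  simp only [dotProduct, Matrix.mulVec, curvMatrix, bisec, Matrix.of_apply, Pi.star_apply,
    Finset.mul_sum, Finset.sum_mul]
  rw [h fun a b c d => star (v d) * (R a b c d * u a * star (u b) * v c)]
  exact sum_congr rfl fun _ _ => sum_congr rfl fun _ _ => sum_congr rfl fun _ _ =>
    sum_congr rfl fun _ _ => by ring

theorem bisec_comm (hR : IsKahlerCurv R) (u v : Fin n → ℂ) : bisec R u v = bisec R v u := by
  rw [← star_dotProduct_curvMatrix_mulVec]
  simp only [dotProduct, Matrix.mulVec, curvMatrix, bisec, Matrix.of_apply, Pi.star_apply,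
    Finset.mul_sum, Finset.sum_mul]
  rw [Finset.sum_comm]
  refine sum_congr rfl fun c _ => sum_congr rfl fun d _ => sum_congr rfl fun a _ =>
    sum_congr rfl fun b _ => ?_
  rw [hR.apply_swap_pairs]
  ring

theorem star_dotProduct_cqbMatrix_mulVec (u v : Fin n → ℂ) :
    star v ⬝ᵥ cqbMatrix R u *ᵥ v = (star u ⬝ᵥ u) * ricForm R v v - bisec R u v := by
  rw [cqbMatrix, Matrix.sub_mulVec, dotProduct_sub, Matrix.smul_mulVec, dotProduct_smul,
    star_dotProduct_ricMatrix_mulVec, star_dotProduct_curvMatrix_mulVec, smul_eq_mul]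

theorem cqb_vecMulVec (u v : Fin n → ℂ) :
    CQB R (Matrix.vecMulVec u v) = (star v ⬝ᵥ cqbMatrix R u *ᵥ v).re := by
  rw [star_dotProduct_cqbMatrix_mulVec, CQB]
  congr 2
  · simp only [ricForm, dotProduct, Finset.mul_sum, Finset.sum_mul, Matrix.vecMulVec_apply,
      star_mul', Pi.star_apply]
    exact sum_congr rfl fun _ _ => sum_congr rfl fun _ _ => sum_congr rfl fun _ _ => by ring
  · simp only [bisec, Matrix.vecMulVec_apply, star_mul']
    exact sum_congr rfl fun _ _ => sum_congr rfl fun _ _ => sum_congr rfl fun _ _ =>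
      sum_congr rfl fun _ _ => by ring

theorem isHermitian_ricMatrix (hR : IsKahlerCurv R) : (ricMatrix R).IsHermitian := by
  ext a b
  simp only [Matrix.conjTranspose_apply, ricMatrix, ricT, Matrix.of_apply, star_sum, hR.2.2]

theorem isHermitian_curvMatrix (hR : IsKahlerCurv R) (u : Fin n → ℂ) :
    (curvMatrix R u).IsHermitian := by
  ext c d
  simp only [Matrix.conjTranspose_apply, curvMatrix, Matrix.of_apply, star_sum, star_mul',
    star_star, hR.2.2]
  rw [Finset.sum_comm]
  exact sum_congr rfl fun _ _ => sum_congr rfl fun _ _ => by ring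

theorem isHermitian_cqbMatrix (hR : IsKahlerCurv R) (u : Fin n → ℂ) :
    (cqbMatrix R u).IsHermitian := by
  refine Matrix.IsHermitian.sub ?_ (hR.isHermitian_curvMatrix u)
  rw [Matrix.IsHermitian, Matrix.conjTranspose_smul, hR.isHermitian_ricMatrix.eq,
    ← Matrix.star_dotProduct]

theorem posSemidef_cqbMatrix (hR : IsKahlerCurv R)
    (hCQB : ∀ A : Matrix (Fin n) (Fin n) ℂ, A.rank ≤ 1 → 0 ≤ CQB R A) (u : Fin n → ℂ) :
    (cqbMatrix R u).PosSemidef := by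
  refine .of_dotProduct_mulVec_nonneg (hR.isHermitian_cqbMatrix u) fun v => ?_
  refine Complex.le_def.mpr ⟨?_, ?_⟩
  · rw [← cqb_vecMulVec]
    exact hCQB _ (Matrix.rank_vecMulVec_le u v)
  · exact ((hR.isHermitian_cqbMatrix u).im_star_dotProduct_mulVec_self v).symm

theorem ricForm_self_eq_zero (hR : IsKahlerCurv R) {x : Fin n → ℂ}
    (hx : (ricForm R x x).re = 0) : ricForm R x x = 0 := by
  refine Complex.ext hx ?_
  rw [← star_dotProduct_ricMatrix_mulVec]
  exact hR.isHermitian_ricMatrix.im_star_dotProduct_mulVec_self x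

theorem sum_cqbMatrix_single (hR : IsKahlerCurv R) :
    ∑ i, cqbMatrix R (Pi.single i 1) = ((n : ℂ) - 1) • ricMatrix R := by
  ext d c
  simp [cqbMatrix, curvMatrix, ricMatrix, ricT, Matrix.sum_apply, sub_mul, Pi.single_apply,
    hR.apply_swap_pairs c d]

theorem ricMatrix_mulVec_eq_zero (hR : IsKahlerCurv R) (hn : 2 ≤ n)
    (hCQB : ∀ A : Matrix (Fin n) (Fin n) ℂ, A.rank ≤ 1 → 0 ≤ CQB R A)
    {x : Fin n → ℂ} (hx : ricForm R x x = 0) : ricMatrix R *ᵥ x = 0 := by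
  have hpos := Matrix.posSemidef_sum univ fun i _ =>
    hR.posSemidef_cqbMatrix hCQB (Pi.single i 1)
  rw [hR.sum_cqbMatrix_single] at hpos
  have h := (hpos.dotProduct_mulVec_zero_iff x).mp (by
    rw [Matrix.smul_mulVec, dotProduct_smul, star_dotProduct_ricMatrix_mulVec, hx, smul_zero])
  rw [Matrix.smul_mulVec] at h
  refine (smul_eq_zero.mp h).resolve_left (sub_ne_zero.mpr ?_)
  exact_mod_cast (by omega : n ≠ 1)

theorem trace_curvMatrix (x : Fin n → ℂ) : (curvMatrix R x).trace = ricForm R x x := by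
  simp only [Matrix.trace, Matrix.diag_apply, curvMatrix, Matrix.of_apply, ricForm, ricT,
    Finset.sum_mul]
  rw [Finset.sum_comm]
  exact sum_congr rfl fun _ _ => Finset.sum_comm

theorem bisec_eq_zero (hR : IsKahlerCurv R)
    (hCQB : ∀ A : Matrix (Fin n) (Fin n) ℂ, A.rank ≤ 1 → 0 ≤ CQB R A)
    {x : Fin n → ℂ} (hx : ricForm R x x = 0) (u : Fin n → ℂ) : bisec R u x = 0 := by
  have hpos : (-curvMatrix R x).PosSemidef := by
    refine .of_dotProduct_mulVec_nonneg (hR.isHermitian_curvMatrix x).neg fun v => ?_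
    have h := (hR.posSemidef_cqbMatrix hCQB v).dotProduct_mulVec_nonneg x
    rwa [star_dotProduct_cqbMatrix_mulVec, hx, mul_zero, zero_sub, hR.bisec_comm,
      ← star_dotProduct_curvMatrix_mulVec, ← dotProduct_neg, ← Matrix.neg_mulVec] at h
  have hzero := hpos.trace_eq_zero_iff.mp (by
    rw [Matrix.trace_neg, trace_curvMatrix, hx, neg_zero])
  rw [hR.bisec_comm, ← star_dotProduct_curvMatrix_mulVec, neg_eq_zero.mp hzero,
    Matrix.zero_mulVec, dotProduct_zero]

theorem curvMatrix_mulVec_eq_zero (hR : IsKahlerCurv R) (hn : 2 ≤ n)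
    (hCQB : ∀ A : Matrix (Fin n) (Fin n) ℂ, A.rank ≤ 1 → 0 ≤ CQB R A)
    {x : Fin n → ℂ} (hx : ricForm R x x = 0) (u : Fin n → ℂ) : curvMatrix R u *ᵥ x = 0 := by
  have h := ((hR.posSemidef_cqbMatrix hCQB u).dotProduct_mulVec_zero_iff x).mp (by
    rw [star_dotProduct_cqbMatrix_mulVec, hx, hR.bisec_eq_zero hCQB hx, mul_zero, sub_zero])
  rwa [cqbMatrix, Matrix.sub_mulVec, Matrix.smul_mulVec, hR.ricMatrix_mulVec_eq_zero hn hCQB hx,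
    smul_zero, zero_sub, neg_eq_zero] at h

theorem sum_apply_mul_eq_zero (hR : IsKahlerCurv R) (hn : 2 ≤ n)
    (hCQB : ∀ A : Matrix (Fin n) (Fin n) ℂ, A.rank ≤ 1 → 0 ≤ CQB R A)
    {x : Fin n → ℂ} (hx : ricForm R x x = 0) (b c d : Fin n) : ∑ a, R a b c d * x a = 0 := by
  have h : (Matrix.of fun d c => ∑ a, R a b c d * x a) = 0 := by
    refine Matrix.eq_zero_of_forall_star_dotProduct_mulVec _ fun u => ?_
    refine Eq.trans ?_ (congrFun (hR.curvMatrix_mulVec_eq_zero hn hCQB hx u) b)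
    simp only [dotProduct, Matrix.mulVec, curvMatrix, Matrix.of_apply, Pi.star_apply,
      Finset.mul_sum, Finset.sum_mul]
    rw [Finset.sum_comm, Finset.sum_comm_cycle]
    refine sum_congr rfl fun a _ => ?_
    refine sum_congr rfl fun c _ => sum_congr rfl fun d _ => ?_
    rw [hR.apply_swap_pairs a b c d]
    ring
  exact congrFun (congrFun h d) c

end IsKahlerCurv

/-- Remark after Corollary 2.5: under `CQB₁ ≥ 0`, any vector `x` with `Ric(x,x̄) = 0`
lies in the kernel of the curvature tensor. -/
theorem ric_null_in_kernel_of_cqb_one_nonneg (n : ℕ) (hn : 2 ≤ n)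
    (R : Fin n → Fin n → Fin n → Fin n → ℂ) (hR : IsKahlerCurv R)
    (hCQB : ∀ A : Matrix (Fin n) (Fin n) ℂ, A.rank ≤ 1 → 0 ≤ CQB R A)
    (x : Fin n → ℂ) (hx : (ricForm R x x).re = 0) :
    ∀ y z w : Fin n → ℂ,
      ∑ a, ∑ b, ∑ c, ∑ d, R a b c d * x a * star (y b) * z c * star (w d) = 0 := by
  intro y z w
  rw [Finset.sum_comm]
  refine sum_eq_zero fun b _ => ?_
  rw [Finset.sum_comm]
  refine sum_eq_zero fun c _ => ?_
  rw [Finset.sum_comm]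
  refine sum_eq_zero fun d _ => ?_
  rw [← Finset.sum_mul, ← Finset.sum_mul, ← Finset.sum_mul,
    hR.sum_apply_mul_eq_zero hn hCQB (hR.ricForm_self_eq_zero hx)]
  simp
end

section
/- Let V be a seminormed real vector space, let A, B ∈ V, let K, a₁, a₂, b₁, b₂ be nonnegative real numbers with ‖A‖² ≤ K·a₁·a₂ and ‖B‖² ≤ K·b₁·b₂, and let η ∈ [0,1]. Then ‖η•A + (1−η)•B‖² ≤ K·(η·a₁ + (1−η)·b₁)·(η·a₂ + (1−η)·b₂). (The convexity lemma for the sets C(t), proved in Theorem 3.1.) -/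
/-- The convexity lemma for the sets `C(t)` from the proof of Theorem 3.1:
if `‖A‖² ≤ K·a₁·a₂` and `‖B‖² ≤ K·b₁·b₂` then the convex combination satisfies the
corresponding inequality with the convex combinations of the bounds. -/
theorem convexity_lemma {V : Type*} [SeminormedAddCommGroup V] [NormedSpace ℝ V]
    (A B : V) (K a₁ a₂ b₁ b₂ η : ℝ)
    (hK : 0 ≤ K) (ha₁ : 0 ≤ a₁) (ha₂ : 0 ≤ a₂) (hb₁ : 0 ≤ b₁) (hb₂ : 0 ≤ b₂)
    (hη₀ : 0 ≤ η) (hη₁ : η ≤ 1)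
    (hA : ‖A‖ ^ 2 ≤ K * a₁ * a₂) (hB : ‖B‖ ^ 2 ≤ K * b₁ * b₂) :
    ‖η • A + (1 - η) • B‖ ^ 2 ≤
      K * (η * a₁ + (1 - η) * b₁) * (η * a₂ + (1 - η) * b₂) := by
  have hcross : 2 * (‖A‖ * ‖B‖) ≤ K * (a₁ * b₂ + b₁ * a₂) := by
    refine abs_le_of_sq_le_sq' ?_ (by positivity) |>.2
    have hmul : ‖A‖ ^ 2 * ‖B‖ ^ 2 ≤ (K * a₁ * a₂) * (K * b₁ * b₂) := by gcongr
    nlinarith [sq_nonneg (K * (a₁ * b₂ - b₁ * a₂))]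
  have hη : 0 ≤ 1 - η := sub_nonneg.2 hη₁
  have hnorm : ‖η • A + (1 - η) • B‖ ≤ η * ‖A‖ + (1 - η) * ‖B‖ := by
    refine (norm_add_le _ _).trans_eq ?_
    rw [norm_smul_of_nonneg hη₀, norm_smul_of_nonneg hη]
  calc ‖η • A + (1 - η) • B‖ ^ 2
      ≤ (η * ‖A‖ + (1 - η) * ‖B‖) ^ 2 := by gcongr
    _ = η ^ 2 * ‖A‖ ^ 2 + η * (1 - η) * (2 * (‖A‖ * ‖B‖)) + (1 - η) ^ 2 * ‖B‖ ^ 2 := by ring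
    _ ≤ η ^ 2 * (K * a₁ * a₂) + η * (1 - η) * (K * (a₁ * b₂ + b₁ * a₂)) +
        (1 - η) ^ 2 * (K * b₁ * b₂) := by gcongr
    _ = K * (η * a₁ + (1 - η) * b₁) * (η * a₂ + (1 - η) * b₂) := by ring
end

section
/- Let n ≥ 1 and let R be an algebraic Kähler curvature tensor on ℂ^n. Then ᵈCQB₁ ≤ 0 holds if and only if for all x, y : Fin n → ℂ one has ‖x‖² · Ric(y,ȳ) + R(x,x̄,y,ȳ) ≤ 0; if ᵈCQB₁ < 0 the inequality is strict for nonzero x, y. Moreover, if ᵈCQB₁ ≤ 0 then for every x: (n+1) · ‖x‖² · Ric(x,x̄) ≤ ‖x‖² · Ric(x,x̄) + R(x,x̄,x,x̄) ≤ 0; in particular Ric(x,x̄) ≤ 0 for every x. (The ᵈCQB part of Theorem 5.1, pointwise/algebraic form.) -/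
open Finset

theorem norm2_pos {n : ℕ} {x : Fin n → ℂ} (hx : x ≠ 0) : 0 < norm2 x := by
  obtain ⟨i, hi⟩ := Function.ne_iff.mp hx
  exact Finset.sum_pos' (fun _ _ => by positivity)
    ⟨i, Finset.mem_univ i, by have := norm_pos_iff.mpr hi; positivity⟩

theorem dCQB_vecMulVec {n : ℕ} (R : Fin n → Fin n → Fin n → Fin n → ℂ) (x y : Fin n → ℂ) :
    dCQB R (Matrix.vecMulVec (star y) (star x)) =
      norm2 x * (ricForm R y y).re + (bisec R x y).re := by
  rw [← Complex.re_ofReal_mul, ← Complex.add_re, dCQB, ofReal_norm2]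
  congr 2
  · rw [Finset.sum_mul]
    simp only [ricForm, Finset.mul_sum]
    refine Finset.sum_congr rfl fun a _ => Finset.sum_congr rfl fun c _ =>
      Finset.sum_congr rfl fun d _ => ?_
    simp [Matrix.vecMulVec_apply]
    ring
  · refine Finset.sum_congr rfl fun a _ => Finset.sum_congr rfl fun b _ =>
      Finset.sum_congr rfl fun c _ => Finset.sum_congr rfl fun d _ => ?_
    simp [Matrix.vecMulVec_apply]
    ring

theorem Matrix.exists_eq_vecMulVec_star_of_rank_le_one {n : ℕ} {A : Matrix (Fin n) (Fin n) ℂ}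
    (hA : A.rank ≤ 1) : ∃ x y : Fin n → ℂ, A = Matrix.vecMulVec (star y) (star x) := by
  rw [Matrix.rank_eq_finrank_span_cols, finrank_le_one_iff] at hA
  obtain ⟨⟨u, hu⟩, h⟩ := hA
  choose v hv using fun j => h ⟨A.col j, Submodule.subset_span ⟨j, rfl⟩⟩
  refine ⟨star v, star u, ?_⟩
  ext i j
  have := congrFun (congrArg Subtype.val (hv j)) i
  simp only [SetLike.mk_smul_mk, Pi.smul_apply, smul_eq_mul, Matrix.col_apply] at this
  simp [Matrix.vecMulVec_apply, ← this, mul_comm]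

/-- The unnormalised projection of the `i`-th standard basis vector to the orthogonal complement
of `x`. -/
noncomputable def perpBasis {n : ℕ} (x : Fin n → ℂ) (i a : Fin n) : ℂ :=
  (norm2 x : ℂ) * (if a = i then 1 else 0) - star (x i) * x a

theorem sum_perpBasis_mul_star {n : ℕ} (x : Fin n → ℂ) (a b : Fin n) :
    ∑ i, perpBasis x i a * star (perpBasis x i b) =
      (norm2 x : ℂ) ^ 2 * (if a = b then 1 else 0) - norm2 x * (x a * star (x b)) := by
  have h : ∀ i, perpBasis x i a * star (perpBasis x i b) =
      (norm2 x : ℂ) ^ 2 * ((if a = i then 1 else 0) * (if b = i then 1 else 0))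
        - norm2 x * ((if a = i then 1 else 0) * (x i * star (x b)))
        - norm2 x * ((if b = i then 1 else 0) * (star (x i) * x a))
        + (x i * star (x i)) * (x a * star (x b)) := by
    intro i
    have hstar : star (norm2 x : ℂ) = norm2 x := Complex.conj_ofReal _
    simp only [perpBasis, star_sub, star_mul', star_star, apply_ite star, star_one, star_zero,
      hstar]
    ring
  simp only [h, Finset.sum_add_distrib, Finset.sum_sub_distrib, ← Finset.mul_sum,
    ← Finset.sum_mul, ← ofReal_norm2]
  simp [eq_comm]
  ring

theorem sum_perpBasis_form {n : ℕ} (H : Fin n → Fin n → ℂ) (x : Fin n → ℂ) :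
    ∑ i, ∑ a, ∑ b, H a b * (perpBasis x i a * star (perpBasis x i b)) =
      (norm2 x : ℂ) ^ 2 * ∑ a, H a a - norm2 x * ∑ a, ∑ b, H a b * (x a * star (x b)) := by
  calc
    _ = ∑ a, ∑ b, H a b * ∑ i, perpBasis x i a * star (perpBasis x i b) := by
      simp only [Finset.mul_sum]
      rw [Finset.sum_comm]
      exact Finset.sum_congr rfl fun a _ => Finset.sum_comm
    _ = (∑ a, ∑ b, (norm2 x : ℂ) ^ 2 * (H a b * (if a = b then 1 else 0))) -
        ∑ a, ∑ b, norm2 x * (H a b * (x a * star (x b))) := by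
      simp only [sum_perpBasis_mul_star, ← Finset.sum_sub_distrib]
      exact Finset.sum_congr rfl fun a _ => Finset.sum_congr rfl fun b _ => by ring
    _ = _ := by
      simp only [← Finset.mul_sum]
      simp

/-- The Hermitian form whose value at `x` is `‖x‖² Ric(y, ȳ) + R(x, x̄, y, ȳ)`. -/
noncomputable def ricBisecForm {n : ℕ} (R : Fin n → Fin n → Fin n → Fin n → ℂ) (y : Fin n → ℂ)
    (a b : Fin n) : ℂ :=
  (if a = b then 1 else 0) * ricForm R y y + ∑ c, ∑ d, R a b c d * y c * star (y d)

theorem sum_ricBisecForm {n : ℕ} (R : Fin n → Fin n → Fin n → Fin n → ℂ) (x y : Fin n → ℂ) :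
    ∑ a, ∑ b, ricBisecForm R y a b * (x a * star (x b)) =
      norm2 x * ricForm R y y + bisec R x y := by
  simp only [ricBisecForm, add_mul, Finset.sum_add_distrib]
  congr 1
  · simp only [ofReal_norm2, Finset.sum_mul]
    simp [mul_comm]
  · simp only [bisec, Finset.sum_mul]
    exact Finset.sum_congr rfl fun a _ => Finset.sum_congr rfl fun b _ =>
      Finset.sum_congr rfl fun c _ => Finset.sum_congr rfl fun d _ => by ring

theorem trace_ricBisecForm {n : ℕ} {R : Fin n → Fin n → Fin n → Fin n → ℂ} (hR : IsKahlerCurv R)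
    (y : Fin n → ℂ) : ∑ a, ricBisecForm R y a a = ((n : ℂ) + 1) * ricForm R y y := by
  have h : ∀ a c d, R a a c d = R c d a a := fun a c d => by rw [hR.1, hR.2.1]
  simp only [ricBisecForm, Finset.sum_add_distrib, add_mul]
  congr 1
  · simp
  · rw [Finset.sum_comm, one_mul, ricForm]
    refine Finset.sum_congr rfl fun c _ => ?_
    rw [Finset.sum_comm]
    refine Finset.sum_congr rfl fun d _ => ?_
    simp only [ricT, Finset.sum_mul, h]

theorem ricci_le_of_forall_nonpos {n : ℕ} {R : Fin n → Fin n → Fin n → Fin n → ℂ}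
    (hR : IsKahlerCurv R) {y : Fin n → ℂ} (hy : y ≠ 0)
    (h : ∀ x : Fin n → ℂ, norm2 x * (ricForm R y y).re + (bisec R x y).re ≤ 0) :
    ((n : ℝ) + 1) * norm2 y * (ricForm R y y).re ≤
      norm2 y * (ricForm R y y).re + (bisec R y y).re := by
  have hsum := sum_perpBasis_form (ricBisecForm R y) y
  simp only [sum_ricBisecForm, trace_ricBisecForm hR] at hsum
  have hre := congrArg Complex.re hsum
  have hle : ∑ i, (norm2 (perpBasis y i) * (ricForm R y y).re + (bisec R (perpBasis y i) y).re)
      ≤ 0 := Finset.sum_nonpos fun i _ => h _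
  have hcast : (norm2 y : ℂ) ^ 2 * (((n : ℂ) + 1) * ricForm R y y) =
      ((norm2 y ^ 2 * ((n : ℝ) + 1) : ℝ) : ℂ) * ricForm R y y := by
    push_cast
    ring
  rw [hcast] at hre
  simp only [Complex.re_sum, Complex.add_re, Complex.sub_re, Complex.re_ofReal_mul] at hre
  rw [hre] at hle
  refine le_of_mul_le_mul_left ?_ (norm2_pos hy)
  linarith

/-- Theorem 5.1 (ᵈCQB part): `ᵈCQB₁ ≤ 0` iff `‖x‖²·Ric(y,ȳ) + R(x,x̄,y,ȳ) ≤ 0` for all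
`x, y`; strict for nonzero vectors when `ᵈCQB₁ < 0`; and under `ᵈCQB₁ ≤ 0` one has
`(n+1)·‖x‖²·Ric(x,x̄) ≤ ‖x‖²·Ric(x,x̄) + R(x,x̄,x,x̄) ≤ 0`, in particular `Ric ≤ 0`. -/
theorem dcqb_one_nonpos (n : ℕ) (hn : 1 ≤ n)
    (R : Fin n → Fin n → Fin n → Fin n → ℂ) (hR : IsKahlerCurv R) :
    ((∀ A : Matrix (Fin n) (Fin n) ℂ, A.rank ≤ 1 → dCQB R A ≤ 0) ↔
      (∀ x y : Fin n → ℂ, norm2 x * (ricForm R y y).re + (bisec R x y).re ≤ 0)) ∧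
    ((∀ A : Matrix (Fin n) (Fin n) ℂ, A ≠ 0 → A.rank ≤ 1 → dCQB R A < 0) →
      (∀ x y : Fin n → ℂ, x ≠ 0 → y ≠ 0 →
        norm2 x * (ricForm R y y).re + (bisec R x y).re < 0)) ∧
    ((∀ A : Matrix (Fin n) (Fin n) ℂ, A.rank ≤ 1 → dCQB R A ≤ 0) →
      ∀ x : Fin n → ℂ,
        ((n : ℝ) + 1) * norm2 x * (ricForm R x x).re ≤
          norm2 x * (ricForm R x x).re + (bisec R x x).re ∧
        norm2 x * (ricForm R x x).re + (bisec R x x).re ≤ 0 ∧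
        (ricForm R x x).re ≤ 0) := by
  have hiff : (∀ A : Matrix (Fin n) (Fin n) ℂ, A.rank ≤ 1 → dCQB R A ≤ 0) ↔
      (∀ x y : Fin n → ℂ, norm2 x * (ricForm R y y).re + (bisec R x y).re ≤ 0) := by
    constructor
    · intro h x y
      rw [← dCQB_vecMulVec]
      exact h _ (Matrix.rank_vecMulVec_le _ _)
    · intro h A hA
      obtain ⟨x, y, rfl⟩ := Matrix.exists_eq_vecMulVec_star_of_rank_le_one hA
      rw [dCQB_vecMulVec]
      exact h x y
  refine ⟨hiff, fun h x y hx hy => ?_, fun h x => ?_⟩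
  · rw [← dCQB_vecMulVec]
    refine h _ ?_ (Matrix.rank_vecMulVec_le _ _)
    simp [Matrix.vecMulVec_eq_zero, hx, hy]
  · have hF := hiff.mp h
    by_cases hx : x = 0
    · subst hx
      simp [norm2, ricForm, bisec]
    · have hlow := ricci_le_of_forall_nonpos hR hx fun z => hF z x
      refine ⟨hlow, hF x x, ?_⟩
      have hpos : 0 < ((n : ℝ) + 1) * norm2 x := mul_pos (by positivity) (norm2_pos hx)
      exact nonpos_of_mul_nonpos_right (hlow.trans (hF x x)) hpos
end

section
/- Let n ≥ 2 and let b, c, e be positive real numbers with n·b·e > (n−1)²·c². For a matrix A : Matrix (Fin n) (Fin n) ℂ (with distinguished index 0 in Fin n) define P(A) := (b + (n−1)·c) · ∑_ℓ ‖A ℓ 0‖² + (c + n·e) · ∑_ℓ ∑_{i ≠ 0} ‖A ℓ i‖² and Q(A) := b·‖A 0 0‖² + 2e · ∑_{i ≠ 0} ‖A i i‖² + c · ∑_{i ≠ 0} ‖A 0 i + A i 0‖² + e · ∑_{i < k, i ≠ 0, k ≠ 0} ‖A i k + A k i‖². Then for every A ≠ 0 one has P(A) + Q(A) > 0 and P(A)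 − Q(A) > 0. (The pointwise computation proving Theorem 5.3: the Mostow–Siu type metrics have CQB < 0 and ᵈCQB < 0.) -/
open Finset

/-- The quadratic form `P(A)` from the proof of Theorem 5.3. -/
noncomputable def Pform (n : ℕ) [NeZero n] (b c e : ℝ)
    (A : Matrix (Fin n) (Fin n) ℂ) : ℝ :=
  (b + ((n : ℝ) - 1) * c) * (∑ l, ‖A l 0‖ ^ 2) +
  (c + (n : ℝ) * e) * (∑ l, ∑ i ∈ Finset.univ.filter (fun i => i ≠ (0 : Fin n)), ‖A l i‖ ^ 2)

/-- The quadratic form `Q(A)` from the proof of Theorem 5.3. -/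
noncomputable def Qform (n : ℕ) [NeZero n] (b c e : ℝ)
    (A : Matrix (Fin n) (Fin n) ℂ) : ℝ :=
  b * ‖A 0 0‖ ^ 2 +
  2 * e * (∑ i ∈ Finset.univ.filter (fun i => i ≠ (0 : Fin n)), ‖A i i‖ ^ 2) +
  c * (∑ i ∈ Finset.univ.filter (fun i => i ≠ (0 : Fin n)), ‖A 0 i + A i 0‖ ^ 2) +
  e * (∑ i ∈ Finset.univ.filter (fun i => i ≠ (0 : Fin n)),
        ∑ k ∈ Finset.univ.filter (fun k => i < k ∧ k ≠ (0 : Fin n)), ‖A i k + A k i‖ ^ 2)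

/-- Splitting a double sum over a finite linear order into its diagonal and the pairs `i < k`. -/
lemma Finset.sum_diag_add_sum_lt {ι : Type*} [LinearOrder ι] (s : Finset ι) (f : ι → ι → ℝ) :
    ∑ i ∈ s, f i i + ∑ i ∈ s, ∑ k ∈ s with i < k, (f i k + f k i) =
      ∑ i ∈ s, ∑ k ∈ s, f i k := by
  have hdiag : ∑ i ∈ s, f i i = ∑ i ∈ s, ∑ k ∈ s, if i = k then f i k else 0 :=
    Finset.sum_congr rfl fun i hi => by rw [Finset.sum_ite_eq, if_pos hi]
  have hswap : ∑ i ∈ s, ∑ k ∈ s, (if i < k then f k i else 0) =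
      ∑ i ∈ s, ∑ k ∈ s, if k < i then f i k else 0 := Finset.sum_comm
  simp only [Finset.sum_filter, Finset.sum_add_distrib]
  rw [hswap, hdiag]
  simp only [← Finset.sum_add_distrib]
  refine Finset.sum_congr rfl fun i _ => Finset.sum_congr rfl fun k _ => ?_
  rcases lt_trichotomy i k with h | h | h
  · simp [h, h.ne, h.not_gt]
  · simp [h]
  · simp [h, h.ne', h.not_gt]

/-- Weighted Young inequality for the square of the norm of a sum. -/
lemma mul_norm_add_sq_le {E : Type*} [SeminormedAddCommGroup E] {c t s : ℝ} (hc : 0 < c)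
    (ht : 0 < t) (hts : t * s = c ^ 2) (x y : E) :
    c * ‖x + y‖ ^ 2 ≤ (c + t) * ‖x‖ ^ 2 + (c + s) * ‖y‖ ^ 2 := by
  have h : ‖x + y‖ ^ 2 ≤ (‖x‖ + ‖y‖) ^ 2 := by gcongr; exact norm_add_le x y
  have hs : s = c ^ 2 / t := by field_simp; linarith
  have key : 2 * c * ‖x‖ * ‖y‖ ≤ t * ‖x‖ ^ 2 + s * ‖y‖ ^ 2 := by
    have : t * ‖x‖ ^ 2 + s * ‖y‖ ^ 2 - 2 * c * ‖x‖ * ‖y‖ = (t * ‖x‖ - c * ‖y‖) ^ 2 / t := by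
      rw [hs]; field_simp; ring
    have : 0 ≤ (t * ‖x‖ - c * ‖y‖) ^ 2 / t := by positivity
    linarith
  nlinarith [mul_le_mul_of_nonneg_left h hc.le]

/-- A combination of nonnegative reals, not all zero, with positive coefficients is positive. -/
lemma four_term_combination_pos {p q r s a x y z : ℝ} (hp : 0 < p) (hq : 0 < q) (hr : 0 < r)
    (hs : 0 < s) (ha : 0 ≤ a) (hx : 0 ≤ x) (hy : 0 ≤ y) (hz : 0 ≤ z)
    (h : 0 < a + x + y + z) : 0 < p * a + q * x + r * y + s * z := by
  rcases ha.eq_or_lt with rfl | ha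
  · rcases hx.eq_or_lt with rfl | hx
    · rcases hy.eq_or_lt with rfl | hy
      · have : 0 < z := by linarith
        positivity
      · positivity
    · positivity
  · positivity

/-- The form `Pform` in terms of the four blocks of the matrix. -/
lemma Pform_eq (n : ℕ) [NeZero n] (b c e : ℝ) (A : Matrix (Fin n) (Fin n) ℂ) :
    Pform n b c e A =
      (b + ((n : ℝ) - 1) * c) * (‖A 0 0‖ ^ 2 + ∑ i with i ≠ 0, ‖A i 0‖ ^ 2) +
      (c + (n : ℝ) * e) *
        (∑ i with i ≠ 0, ‖A 0 i‖ ^ 2 + ∑ l with l ≠ 0, ∑ i with i ≠ 0, ‖A l i‖ ^ 2) := by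
  have h (f : Fin n → ℝ) : ∑ l, f l = f 0 + ∑ l with l ≠ 0, f l := by
    rw [Finset.filter_ne' Finset.univ 0, Finset.add_sum_erase _ _ (Finset.mem_univ _)]
  rw [Pform, h, h fun l => ∑ i with i ≠ 0, ‖A l i‖ ^ 2]

/-- The entries of a nonzero matrix, grouped in four blocks, have positive total square norm. -/
lemma sum_blocks_norm_sq_pos {n : ℕ} [NeZero n] {A : Matrix (Fin n) (Fin n) ℂ} (hA : A ≠ 0) :
    0 < ‖A 0 0‖ ^ 2 + ∑ i with i ≠ 0, ‖A i 0‖ ^ 2 + ∑ i with i ≠ 0, ‖A 0 i‖ ^ 2 +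
      ∑ l with l ≠ 0, ∑ i with i ≠ 0, ‖A l i‖ ^ 2 := by
  obtain ⟨i, k, hik⟩ : ∃ i k, A i k ≠ 0 := by
    by_contra! h
    exact hA (Matrix.ext h)
  have hpos : 0 < ‖A i k‖ ^ 2 := by positivity
  have hrow (l : Fin n) (hk : k ≠ 0) : ‖A l k‖ ^ 2 ≤ ∑ j with j ≠ 0, ‖A l j‖ ^ 2 :=
    Finset.single_le_sum (f := fun j => ‖A l j‖ ^ 2) (fun _ _ => by positivity) (by simpa using hk)
  have h1 : 0 ≤ ‖A 0 0‖ ^ 2 := by positivity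
  have h2 : 0 ≤ ∑ i with i ≠ 0, ‖A i 0‖ ^ 2 := by positivity
  have h3 : 0 ≤ ∑ i with i ≠ 0, ‖A 0 i‖ ^ 2 := by positivity
  have h4 : 0 ≤ ∑ l with l ≠ 0, ∑ i with i ≠ 0, ‖A l i‖ ^ 2 := by positivity
  by_cases hi : i = 0 <;> by_cases hk : k = 0
  · subst hi hk; linarith
  · subst hi; linarith [hrow 0 hk]
  · subst hk
    have : ‖A i 0‖ ^ 2 ≤ ∑ j with j ≠ 0, ‖A j 0‖ ^ 2 :=
      Finset.single_le_sum (f := fun j => ‖A j 0‖ ^ 2) (fun _ _ => by positivity)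
        (by simpa using hi)
    linarith
  · have : ∑ j with j ≠ 0, ‖A i j‖ ^ 2 ≤ ∑ l with l ≠ 0, ∑ j with j ≠ 0, ‖A l j‖ ^ 2 :=
      Finset.single_le_sum (f := fun l => ∑ j with j ≠ 0, ‖A l j‖ ^ 2)
        (fun _ _ => by positivity) (by simpa using hi)
    linarith [hrow i hk]

/-- An upper bound for `Qform` in terms of the four blocks of the matrix. -/
lemma Qform_le (n : ℕ) [NeZero n] (b : ℝ) {c e t s : ℝ} (hc : 0 < c) (he : 0 < e)
    (ht : 0 < t) (hts : t * s = c ^ 2) (A : Matrix (Fin n) (Fin n) ℂ) :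
    Qform n b c e A ≤ b * ‖A 0 0‖ ^ 2 + (c + s) * ∑ i with i ≠ 0, ‖A i 0‖ ^ 2 +
      (c + t) * ∑ i with i ≠ 0, ‖A 0 i‖ ^ 2 +
      2 * e * ∑ l with l ≠ 0, ∑ i with i ≠ 0, ‖A l i‖ ^ 2 := by
  have hcross : c * ∑ i with i ≠ 0, ‖A 0 i + A i 0‖ ^ 2 ≤
      (c + t) * ∑ i with i ≠ 0, ‖A 0 i‖ ^ 2 + (c + s) * ∑ i with i ≠ 0, ‖A i 0‖ ^ 2 := by
    simp only [Finset.mul_sum, ← Finset.sum_add_distrib]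
    exact Finset.sum_le_sum fun i _ => mul_norm_add_sq_le hc ht hts _ _
  have hpairs : ∑ i with i ≠ 0, ∑ k with i < k ∧ k ≠ 0, ‖A i k + A k i‖ ^ 2 ≤
      2 * ∑ i with i ≠ 0, ∑ k ∈ Finset.univ.filter (fun k : Fin n => k ≠ 0) with i < k,
        (‖A i k‖ ^ 2 + ‖A k i‖ ^ 2) := by
    simp only [Finset.mul_sum]
    refine Finset.sum_le_sum fun i _ => ?_
    rw [Finset.filter_filter]
    simp only [and_comm]
    refine Finset.sum_le_sum fun k _ => ?_
    nlinarith [mul_norm_add_sq_le one_pos one_pos (s := 1) (by norm_num) (A i k) (A k i)]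
  have hsplit := Finset.sum_diag_add_sum_lt (Finset.univ.filter fun i : Fin n => i ≠ 0)
    fun i k => ‖A i k‖ ^ 2
  rw [Qform, ← hsplit]
  linarith [mul_le_mul_of_nonneg_left hpairs he.le]

/-- The pointwise computation proving Theorem 5.3: under `b, c, e > 0` and
`n·b·e > (n−1)²·c²`, one has `P(A) + Q(A) > 0` and `P(A) − Q(A) > 0` for every
nonzero `A`; i.e. the Mostow–Siu type metrics have `CQB < 0` and `ᵈCQB < 0`. -/
theorem mostow_siu_positivity (n : ℕ) [NeZero n] (hn : 2 ≤ n) (b c e : ℝ)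
    (hb : 0 < b) (hc : 0 < c) (he : 0 < e)
    (hbce : (n : ℝ) * b * e > ((n : ℝ) - 1) ^ 2 * c ^ 2) :
    ∀ A : Matrix (Fin n) (Fin n) ℂ, A ≠ 0 →
      0 < Pform n b c e A + Qform n b c e A ∧
      0 < Pform n b c e A - Qform n b c e A := by
  intro A hA
  have hn' : (2 : ℝ) ≤ n := by exact_mod_cast hn
  have hn1 : 0 < ((n : ℝ) - 1) * c := mul_pos (by linarith) hc
  have hn2 : 0 ≤ ((n : ℝ) - 2) * c := mul_nonneg (by linarith) hc.le
  have hn3 : 0 ≤ ((n : ℝ) - 2) * e := mul_nonneg (by linarith) he.le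
  have hpos := sum_blocks_norm_sq_pos hA
  have h1 : 0 ≤ ‖A 0 0‖ ^ 2 := by positivity
  have h2 : 0 ≤ ∑ i with i ≠ 0, ‖A i 0‖ ^ 2 := by positivity
  have h3 : 0 ≤ ∑ i with i ≠ 0, ‖A 0 i‖ ^ 2 := by positivity
  have h4 : 0 ≤ ∑ l with l ≠ 0, ∑ i with i ≠ 0, ‖A l i‖ ^ 2 := by positivity
  constructor
  · have hQ : 0 ≤ Qform n b c e A := by unfold Qform; positivity
    have hcomb := four_term_combination_pos (p := b + ((n : ℝ) - 1) * c)
      (q := b + ((n : ℝ) - 1) * c) (r := c + n * e) (s := c + n * e)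
      (by positivity) (by positivity) (by positivity) (by positivity) h1 h2 h3 h4 hpos
    rw [Pform_eq]
    linarith
  · have hlt : c ^ 2 / b < n * e := by
      rw [div_lt_iff₀ hb]
      nlinarith [mul_nonneg (mul_nonneg (by linarith : (0 : ℝ) ≤ n)
        (by linarith : (0 : ℝ) ≤ n - 2)) (sq_nonneg c)]
    obtain ⟨t, hbt, htn⟩ := exists_between hlt
    have ht : 0 < t := lt_trans (by positivity) hbt
    have hsb : c ^ 2 / t < b := by
      rw [div_lt_iff₀ hb] at hbt
      rw [div_lt_iff₀ ht]
      linarith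
    have hQ := Qform_le n b hc he ht (mul_div_cancel₀ (c ^ 2) ht.ne') A
    have hcomb := four_term_combination_pos (p := ((n : ℝ) - 1) * c)
      (q := b + ((n : ℝ) - 2) * c - c ^ 2 / t) (r := n * e - t) (s := c + ((n : ℝ) - 2) * e)
      hn1 (by linarith) (by linarith) (by linarith) h1 h2 h3 h4 hpos
    rw [Pform_eq]
    linarith
end

section
/- Let r ≥ 1. For every symmetric A : I → I → ℂ (A α γ = A γ α) one has 2·‖A‖² − Q(A) ≥ 0, and for every nonzero symmetric A one has 2·‖A‖² + Q(A) > 0. (The key inequalities proving Theorem 1.6: the Kähler–Einstein metric on the full flag manifold SU(r+1)/𝕋 has nonnegative CQB and positive ᵈCQB.) -/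
open Finset

/-- The index set `I = {(i,k) : 1 ≤ i < k ≤ r+1}` of positive roots of `sl(r+1)`. -/
def Iset (r : ℕ) : Finset (ℕ × ℕ) :=
  (Finset.range (r + 2) ×ˢ Finset.range (r + 2)).filter
    (fun p => 1 ≤ p.1 ∧ p.1 < p.2 ∧ p.2 ≤ r + 1)

/-- `‖A‖² = ∑_{α,γ ∈ I} ‖A α γ‖²`. -/
noncomputable def normSqFlag (r : ℕ) (A : ℕ × ℕ → ℕ × ℕ → ℂ) : ℝ :=
  ∑ α ∈ Iset r, ∑ γ ∈ Iset r, ‖A α γ‖ ^ 2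

/-- The Calabi–Vesentini quadratic form `Q(A)` of the Kähler–Einstein metric
(`g(i,k) = k − i`, Einstein constant `μ = 2`) on the full flag manifold `SU(r+1)/𝕋`. -/
noncomputable def Qflag (r : ℕ) (A : ℕ × ℕ → ℕ × ℕ → ℂ) : ℝ :=
  (∑ p ∈ Iset r, (2 / ((p.2 : ℝ) - (p.1 : ℝ))) * ‖A p p‖ ^ 2) +
  (∑ i ∈ Finset.range (r + 2), ∑ j ∈ Finset.range (r + 2), ∑ k ∈ Finset.range (r + 2),
    if 1 ≤ i ∧ i < j ∧ j < k ∧ k ≤ r + 1 then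
      (4 / ((k : ℝ) - (i : ℝ))) *
        (‖A (i, j) (i, k)‖ ^ 2 + ‖A (j, k) (i, k)‖ ^ 2 - ‖A (j, k) (i, j)‖ ^ 2)
    else 0) +
  (∑ i ∈ Finset.range (r + 2), ∑ p ∈ Finset.range (r + 2),
    ∑ q ∈ Finset.range (r + 2), ∑ k ∈ Finset.range (r + 2),
    if 1 ≤ i ∧ i < p ∧ p < q ∧ q < k ∧ k ≤ r + 1 then
      8 * (-(((Real.sqrt (((p : ℝ) - i) * ((k : ℝ) - q)) /
                (((k : ℝ) - i) * Real.sqrt (((q : ℝ) - i) * ((k : ℝ) - p)))) : ℝ) : ℂ) *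
              A (q, k) (i, q) * star (A (p, k) (i, p)) +
            (((Real.sqrt ((q : ℝ) - p) /
                Real.sqrt (((k : ℝ) - i) * ((q : ℝ) - i) * ((k : ℝ) - p))) : ℝ) : ℂ) *
              A (p, q) (i, k) * star (A (p, k) (i, q))).re
    else 0)

/-- A sum over pairs of roots, written as a sum over quadruples of indices. -/
lemma sum_Iset_Iset (r : ℕ) (F : ℕ → ℕ → ℕ → ℕ → ℝ) :
    ∑ α ∈ Iset r, ∑ γ ∈ Iset r, F α.1 α.2 γ.1 γ.2 =
      ∑ a ∈ range (r + 2), ∑ b ∈ range (r + 2), ∑ c ∈ range (r + 2), ∑ d ∈ range (r + 2),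
        if (1 ≤ a ∧ a < b ∧ b ≤ r + 1) ∧ (1 ≤ c ∧ c < d ∧ d ≤ r + 1) then F a b c d else 0 := by
  simp only [Iset, sum_filter, sum_product, ite_and]
  refine sum_congr rfl fun a _ => sum_congr rfl fun b _ => ?_
  split_ifs <;> simp

/-- The sum over ordered pairs of roots is the diagonal plus twice the sum over the pairs
that are increasing for the lexicographic order. -/
lemma sum_quadruple_eq_diag_add (r : ℕ) (F : ℕ → ℕ → ℕ → ℕ → ℝ)
    (hF : ∀ a b c d, F a b c d = F c d a b) :
    ∑ α ∈ Iset r, ∑ γ ∈ Iset r, F α.1 α.2 γ.1 γ.2 =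
      ∑ p ∈ Iset r, F p.1 p.2 p.1 p.2 + 2 *
      ∑ a ∈ range (r + 2), ∑ b ∈ range (r + 2), ∑ c ∈ range (r + 2), ∑ d ∈ range (r + 2),
        if ((1 ≤ a ∧ a < b ∧ b ≤ r + 1) ∧ (1 ≤ c ∧ c < d ∧ d ≤ r + 1)) ∧
          (a < c ∨ a = c ∧ b < d) then F a b c d else 0 := by
  have hdiag : ∑ p ∈ Iset r, F p.1 p.2 p.1 p.2 =
      ∑ α ∈ Iset r, ∑ γ ∈ Iset r, if α.1 = γ.1 ∧ α.2 = γ.2 then F α.1 α.2 γ.1 γ.2 else 0 := by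
    refine sum_congr rfl fun p hp => ?_
    rw [sum_eq_single p]
    · simp
    · intro b _ hb
      rw [if_neg]
      rintro ⟨h₁, h₂⟩
      exact hb (Prod.ext h₁.symm h₂.symm)
    · exact fun h => absurd hp h
  rw [hdiag, sum_Iset_Iset r F,
    sum_Iset_Iset r fun a b c d => if a = c ∧ b = d then F a b c d else 0, two_mul]
  set S := range (r + 2)
  have hswap : (∑ a ∈ S, ∑ b ∈ S, ∑ c ∈ S, ∑ d ∈ S,
        if ((1 ≤ a ∧ a < b ∧ b ≤ r + 1) ∧ (1 ≤ c ∧ c < d ∧ d ≤ r + 1)) ∧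
          (a < c ∨ a = c ∧ b < d) then F a b c d else 0) =
      ∑ a ∈ S, ∑ b ∈ S, ∑ c ∈ S, ∑ d ∈ S,
        if ((1 ≤ a ∧ a < b ∧ b ≤ r + 1) ∧ (1 ≤ c ∧ c < d ∧ d ≤ r + 1)) ∧
          (c < a ∨ c = a ∧ d < b) then F a b c d else 0 := by
    simp only [← sum_product']
    refine sum_nbij' (fun x => (x.2.2.1, x.2.2.2, x.1, x.2.1))
      (fun x => (x.2.2.1, x.2.2.2, x.1, x.2.1)) ?_ ?_ (fun _ _ => rfl) (fun _ _ => rfl) ?_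
    · simp only [mem_product]; tauto
    · simp only [mem_product]; tauto
    · intro x _
      rw [hF]
      exact if_congr (by tauto) rfl rfl
  nth_rewrite 2 [hswap]
  simp only [← sum_add_distrib]
  refine sum_congr rfl fun a _ => sum_congr rfl fun b _ => sum_congr rfl fun c _ =>
    sum_congr rfl fun d _ => ?_
  split_ifs <;> first | omega | simp

/-- The diagonal, the pairs sharing an index and the nested or crossing pairs contribute
disjointly to the sum over all ordered pairs of roots. -/
lemma diag_add_two_mul_le_sum (r : ℕ) (F : ℕ → ℕ → ℕ → ℕ → ℝ) (h0 : ∀ a b c d, 0 ≤ F a b c d)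
    (hF : ∀ a b c d, F a b c d = F c d a b) :
    ∑ p ∈ Iset r, F p.1 p.2 p.1 p.2 +
      2 * (∑ i ∈ range (r + 2), ∑ j ∈ range (r + 2), ∑ k ∈ range (r + 2),
        if 1 ≤ i ∧ i < j ∧ j < k ∧ k ≤ r + 1 then F i j i k + F j k i k else 0) +
      2 * (∑ i ∈ range (r + 2), ∑ j ∈ range (r + 2), ∑ k ∈ range (r + 2),
        if 1 ≤ i ∧ i < j ∧ j < k ∧ k ≤ r + 1 then F j k i j else 0) +
      2 * (∑ i ∈ range (r + 2), ∑ p ∈ range (r + 2), ∑ q ∈ range (r + 2), ∑ k ∈ range (r + 2),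
        if 1 ≤ i ∧ i < p ∧ p < q ∧ q < k ∧ k ≤ r + 1 then F p q i k + F p k i q else 0) ≤
    ∑ α ∈ Iset r, ∑ γ ∈ Iset r, F α.1 α.2 γ.1 γ.2 := by
  rw [sum_quadruple_eq_diag_add r F hF]
  set S := range (r + 2)
  have ite_split (P : Prop) [Decidable P] (x y : ℝ) :
      (if P then x + y else 0) = (if P then x else 0) + if P then y else 0 := by
    split_ifs <;> simp
  simp only [ite_split, sum_add_distrib]
  have e₁ : (∑ i ∈ S, ∑ j ∈ S, ∑ k ∈ S,
        if 1 ≤ i ∧ i < j ∧ j < k ∧ k ≤ r + 1 then F i j i k else 0) =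
      ∑ a ∈ S, ∑ b ∈ S, ∑ c ∈ S, ∑ d ∈ S, if a = c then
        (if 1 ≤ a ∧ a < b ∧ b < d ∧ d ≤ r + 1 then F a b c d else 0) else 0 := by
    refine sum_congr rfl fun a ha => sum_congr rfl fun b _ => ?_
    rw [sum_comm]
    refine sum_congr rfl fun d _ => ?_
    rw [sum_ite_eq, if_pos ha]
  have e₂ : (∑ i ∈ S, ∑ j ∈ S, ∑ k ∈ S,
        if 1 ≤ i ∧ i < j ∧ j < k ∧ k ≤ r + 1 then F j k i k else 0) =
      ∑ a ∈ S, ∑ b ∈ S, ∑ c ∈ S, ∑ d ∈ S, if b = d then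
        (if 1 ≤ a ∧ a < c ∧ c < b ∧ b ≤ r + 1 then F a b c d else 0) else 0 := by
    refine sum_congr rfl fun a _ => ?_
    rw [sum_comm]
    refine sum_congr rfl fun b hb => sum_congr rfl fun c _ => ?_
    rw [sum_ite_eq, if_pos hb, hF]
  have e₃ : (∑ i ∈ S, ∑ j ∈ S, ∑ k ∈ S,
        if 1 ≤ i ∧ i < j ∧ j < k ∧ k ≤ r + 1 then F j k i j else 0) =
      ∑ a ∈ S, ∑ b ∈ S, ∑ c ∈ S, ∑ d ∈ S, if b = c then
        (if 1 ≤ a ∧ a < b ∧ b < d ∧ d ≤ r + 1 then F a b c d else 0) else 0 := by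
    refine sum_congr rfl fun a _ => sum_congr rfl fun b hb => ?_
    rw [sum_comm]
    refine sum_congr rfl fun d _ => ?_
    rw [sum_ite_eq, if_pos hb, hF]
  have e₄ : (∑ i ∈ S, ∑ p ∈ S, ∑ q ∈ S, ∑ k ∈ S,
        if 1 ≤ i ∧ i < p ∧ p < q ∧ q < k ∧ k ≤ r + 1 then F p q i k else 0) =
      ∑ a ∈ S, ∑ b ∈ S, ∑ c ∈ S, ∑ d ∈ S,
        if 1 ≤ a ∧ a < c ∧ c < d ∧ d < b ∧ b ≤ r + 1 then F a b c d else 0 := by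
    refine sum_congr rfl fun a _ => ?_
    conv_rhs => rw [sum_comm]
    refine sum_congr rfl fun c _ => ?_
    rw [sum_comm]
    refine sum_congr rfl fun b _ => sum_congr rfl fun d _ => ?_
    rw [hF]
  have e₅ : (∑ i ∈ S, ∑ p ∈ S, ∑ q ∈ S, ∑ k ∈ S,
        if 1 ≤ i ∧ i < p ∧ p < q ∧ q < k ∧ k ≤ r + 1 then F p k i q else 0) =
      ∑ a ∈ S, ∑ b ∈ S, ∑ c ∈ S, ∑ d ∈ S,
        if 1 ≤ a ∧ a < c ∧ c < b ∧ b < d ∧ d ≤ r + 1 then F a b c d else 0 := by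
    refine sum_congr rfl fun a _ => ?_
    rw [sum_comm]
    refine sum_congr rfl fun b _ => sum_congr rfl fun c _ => sum_congr rfl fun d _ => ?_
    rw [hF]
  rw [e₁, e₂, e₃, e₄, e₅]
  have key := sum_le_sum fun a (_ : a ∈ S) => sum_le_sum fun b (_ : b ∈ S) =>
    sum_le_sum fun c (_ : c ∈ S) => sum_le_sum fun d (_ : d ∈ S) =>
    show (if a = c then
        (if 1 ≤ a ∧ a < b ∧ b < d ∧ d ≤ r + 1 then F a b c d else 0) else 0) +
      (if b = d then (if 1 ≤ a ∧ a < c ∧ c < b ∧ b ≤ r + 1 then F a b c d else 0) else 0) +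
      (if b = c then (if 1 ≤ a ∧ a < b ∧ b < d ∧ d ≤ r + 1 then F a b c d else 0) else 0) +
      (if 1 ≤ a ∧ a < c ∧ c < d ∧ d < b ∧ b ≤ r + 1 then F a b c d else 0) +
      (if 1 ≤ a ∧ a < c ∧ c < b ∧ b < d ∧ d ≤ r + 1 then F a b c d else 0) ≤
      if ((1 ≤ a ∧ a < b ∧ b ≤ r + 1) ∧ (1 ≤ c ∧ c < d ∧ d ≤ r + 1)) ∧
          (a < c ∨ a = c ∧ b < d) then F a b c d else 0 by
      have := h0 a b c d
      split_ifs <;> first | omega | linarith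
  simp only [sum_add_distrib] at key
  linarith

/-- In the sum over `i < p < q < k`, each index between `i` and `k` occurs `k - i - 2` times. -/
lemma sum_pairs_between (r : ℕ) (G : ℕ → ℕ → ℕ → ℝ) :
    (∑ i ∈ range (r + 2), ∑ p ∈ range (r + 2), ∑ q ∈ range (r + 2), ∑ k ∈ range (r + 2),
      if 1 ≤ i ∧ i < p ∧ p < q ∧ q < k ∧ k ≤ r + 1 then G i q k + G i p k else 0) =
    ∑ i ∈ range (r + 2), ∑ j ∈ range (r + 2), ∑ k ∈ range (r + 2),
      if 1 ≤ i ∧ i < j ∧ j < k ∧ k ≤ r + 1 then ((k : ℝ) - i - 2) * G i j k else 0 := by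
  have ite_split (P : Prop) [Decidable P] (x y : ℝ) :
      (if P then x + y else 0) = (if P then x else 0) + if P then y else 0 := by
    split_ifs <;> simp
  refine sum_congr rfl fun i _ => ?_
  simp only [ite_split, sum_add_distrib]
  rw [sum_comm]
  simp only [← sum_add_distrib]
  refine sum_congr rfl fun j _ => ?_
  rw [sum_comm]
  refine sum_congr rfl fun k _ => ?_
  rw [sum_add_distrib]
  by_cases h : 1 ≤ i ∧ i < j ∧ j < k ∧ k ≤ r + 1
  · have h₁ : {p ∈ range (r + 2) | 1 ≤ i ∧ i < p ∧ p < j ∧ j < k ∧ k ≤ r + 1} = Ioo i j := by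
      ext p; simp only [mem_filter, mem_range, mem_Ioo]; omega
    have h₂ : {q ∈ range (r + 2) | 1 ≤ i ∧ i < j ∧ j < q ∧ q < k ∧ k ≤ r + 1} = Ioo j k := by
      ext p; simp only [mem_filter, mem_range, mem_Ioo]; omega
    rw [if_pos h, ← sum_filter, ← sum_filter, h₁, h₂, sum_const, sum_const, nsmul_eq_mul,
      nsmul_eq_mul, Nat.card_Ioo, Nat.card_Ioo, Nat.sub_sub, Nat.sub_sub,
      Nat.cast_sub (by omega), Nat.cast_sub (by omega)]
    push_cast
    ring
  · rw [if_neg h, sum_eq_zero fun p _ => if_neg (by omega),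
      sum_eq_zero fun p _ => if_neg (by omega), add_zero]

/-- The two coefficients of the last sum in `Qflag` are at most `1 / (k - i)` and `1 / 2`. -/
lemma Qflag_coeff_bounds {i p q k : ℝ} (h₁ : i + 1 ≤ p) (h₂ : p + 1 ≤ q) (h₃ : q + 1 ≤ k) :
    (0 ≤ √((p - i) * (k - q)) / ((k - i) * √((q - i) * (k - p))) ∧
      √((p - i) * (k - q)) / ((k - i) * √((q - i) * (k - p))) ≤ 1 / (k - i)) ∧
    0 ≤ √(q - p) / √((k - i) * (q - i) * (k - p)) ∧
      √(q - p) / √((k - i) * (q - i) * (k - p)) ≤ 1 / 2 := by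
  have hki : 0 < k - i := by linarith
  have hqi : 0 < q - i := by linarith
  have hkp : 0 < k - p := by linarith
  refine ⟨⟨by positivity, ?_⟩, by positivity, ?_⟩
  · have : √((p - i) * (k - q)) ≤ √((q - i) * (k - p)) :=
      Real.sqrt_le_sqrt (by gcongr <;> linarith)
    have hpos : 0 < √((q - i) * (k - p)) := by positivity
    rw [div_le_div_iff₀ (by positivity) hki]
    nlinarith
  · rw [← Real.sqrt_div' _ (by positivity)]
    refine Real.sqrt_le_iff.2 ⟨by norm_num, ?_⟩
    rw [div_le_iff₀ (by positivity)]
    have h₄ : q - p ≤ q - i := by linarith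
    have h₅ : 4 ≤ (k - i) * (k - p) := by nlinarith
    nlinarith

lemma abs_re_mul_star_le {c b : ℝ} (hc : 0 ≤ c) (hcb : c ≤ b) (x y : ℂ) :
    |((c : ℂ) * x * star y).re| ≤ b / 2 * (‖x‖ ^ 2 + ‖y‖ ^ 2) := by
  refine (Complex.abs_re_le_norm _).trans ?_
  rw [norm_mul, norm_mul, norm_star, Complex.norm_real, Real.norm_of_nonneg hc, mul_assoc]
  calc c * (‖x‖ * ‖y‖) ≤ b * (‖x‖ * ‖y‖) := by gcongr
    _ ≤ b / 2 * (‖x‖ ^ 2 + ‖y‖ ^ 2) := by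
      nlinarith [mul_nonneg (hc.trans hcb) (sq_nonneg (‖x‖ - ‖y‖))]

lemma abs_Qflag_quadruple_le (r : ℕ) (A : ℕ × ℕ → ℕ × ℕ → ℂ) :
    |∑ i ∈ range (r + 2), ∑ p ∈ range (r + 2), ∑ q ∈ range (r + 2), ∑ k ∈ range (r + 2),
      if 1 ≤ i ∧ i < p ∧ p < q ∧ q < k ∧ k ≤ r + 1 then
        8 * (-(((Real.sqrt (((p : ℝ) - i) * ((k : ℝ) - q)) /
                (((k : ℝ) - i) * Real.sqrt (((q : ℝ) - i) * ((k : ℝ) - p)))) : ℝ) : ℂ) *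
              A (q, k) (i, q) * star (A (p, k) (i, p)) +
            (((Real.sqrt ((q : ℝ) - p) /
                Real.sqrt (((k : ℝ) - i) * ((q : ℝ) - i) * ((k : ℝ) - p))) : ℝ) : ℂ) *
              A (p, q) (i, k) * star (A (p, k) (i, q))).re
      else 0| ≤
    (∑ i ∈ range (r + 2), ∑ j ∈ range (r + 2), ∑ k ∈ range (r + 2),
      if 1 ≤ i ∧ i < j ∧ j < k ∧ k ≤ r + 1 then
        ((k : ℝ) - i - 2) * (4 / ((k : ℝ) - i) * ‖A (j, k) (i, j)‖ ^ 2) else 0) +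
    2 * ∑ i ∈ range (r + 2), ∑ p ∈ range (r + 2), ∑ q ∈ range (r + 2), ∑ k ∈ range (r + 2),
      if 1 ≤ i ∧ i < p ∧ p < q ∧ q < k ∧ k ≤ r + 1 then
        ‖A (p, q) (i, k)‖ ^ 2 + ‖A (p, k) (i, q)‖ ^ 2 else 0 := by
  rw [← sum_pairs_between r fun i j k => 4 / ((k : ℝ) - i) * ‖A (j, k) (i, j)‖ ^ 2]
  simp only [mul_sum, ← sum_add_distrib]
  refine (abs_sum_le_sum_abs _ _).trans <| sum_le_sum fun i _ =>
    (abs_sum_le_sum_abs _ _).trans <| sum_le_sum fun p _ =>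
    (abs_sum_le_sum_abs _ _).trans <| sum_le_sum fun q _ =>
    (abs_sum_le_sum_abs _ _).trans <| sum_le_sum fun k _ => ?_
  split_ifs with h
  · obtain ⟨⟨hc₀, hc₁⟩, hd₀, hd₁⟩ := Qflag_coeff_bounds (i := i) (p := p) (q := q) (k := k)
      (by exact_mod_cast h.2.1) (by exact_mod_cast h.2.2.1) (by exact_mod_cast h.2.2.2.1)
    have hx := abs_re_mul_star_le hc₀ hc₁ (A (q, k) (i, q)) (A (p, k) (i, p))
    have hy := abs_re_mul_star_le hd₀ hd₁ (A (p, q) (i, k)) (A (p, k) (i, q))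
    rw [Complex.add_re, neg_mul, neg_mul, Complex.neg_re, abs_mul, abs_of_pos (by norm_num)]
    rw [abs_le] at hx hy
    have h8 : 4 / ((k : ℝ) - i) = 8 * (1 / ((k : ℝ) - i) / 2) := by ring
    rw [h8, ← le_div_iff₀' (by norm_num), abs_le]
    constructor <;> linarith
  · simp

/-- The sum over triples in `Qflag` together with the bound for the composable pairs in the sum
over quadruples, from above and from below. -/
lemma triple_sum_bounds (r : ℕ) (N : ℕ → ℕ → ℕ → ℕ → ℝ) (h0 : ∀ a b c d, 0 ≤ N a b c d) :
    (∑ i ∈ range (r + 2), ∑ j ∈ range (r + 2), ∑ k ∈ range (r + 2),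
        if 1 ≤ i ∧ i < j ∧ j < k ∧ k ≤ r + 1 then
          4 / ((k : ℝ) - i) * (N i j i k + N j k i k - N j k i j) else 0) +
      (∑ i ∈ range (r + 2), ∑ j ∈ range (r + 2), ∑ k ∈ range (r + 2),
        if 1 ≤ i ∧ i < j ∧ j < k ∧ k ≤ r + 1 then
          ((k : ℝ) - i - 2) * (4 / ((k : ℝ) - i) * N j k i j) else 0) ≤
      2 * (∑ i ∈ range (r + 2), ∑ j ∈ range (r + 2), ∑ k ∈ range (r + 2),
        if 1 ≤ i ∧ i < j ∧ j < k ∧ k ≤ r + 1 then N i j i k + N j k i k else 0) +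
      4 * (∑ i ∈ range (r + 2), ∑ j ∈ range (r + 2), ∑ k ∈ range (r + 2),
        if 1 ≤ i ∧ i < j ∧ j < k ∧ k ≤ r + 1 then N j k i j else 0) ∧
    -(4 * (1 - 1 / ((r : ℝ) + 1)) * (∑ i ∈ range (r + 2), ∑ j ∈ range (r + 2),
        ∑ k ∈ range (r + 2), if 1 ≤ i ∧ i < j ∧ j < k ∧ k ≤ r + 1 then N j k i j else 0)) ≤
    (∑ i ∈ range (r + 2), ∑ j ∈ range (r + 2), ∑ k ∈ range (r + 2),
        if 1 ≤ i ∧ i < j ∧ j < k ∧ k ≤ r + 1 then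
          4 / ((k : ℝ) - i) * (N i j i k + N j k i k - N j k i j) else 0) -
      (∑ i ∈ range (r + 2), ∑ j ∈ range (r + 2), ∑ k ∈ range (r + 2),
        if 1 ≤ i ∧ i < j ∧ j < k ∧ k ≤ r + 1 then
          ((k : ℝ) - i - 2) * (4 / ((k : ℝ) - i) * N j k i j) else 0) := by
  have hgap {i j k : ℕ} (h : 1 ≤ i ∧ i < j ∧ j < k ∧ k ≤ r + 1) :
      (2 : ℝ) ≤ k - i ∧ (k : ℝ) - i ≤ r + 1 := by
    have h₁ : i + 2 ≤ k := by omega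
    have h₂ : k ≤ r + 1 + i := by omega
    have h₁' : (i : ℝ) + 2 ≤ k := by exact_mod_cast h₁
    have h₂' : (k : ℝ) ≤ r + 1 + i := by exact_mod_cast h₂
    constructor <;> linarith
  have hmul {m x : ℝ} (hm : 2 ≤ m) : (m - 2) * (4 / m * x) = 4 * x - 2 * (4 / m) * x := by
    have : m ≠ 0 := by linarith
    field_simp
  constructor
  · simp only [mul_sum, ← sum_add_distrib]
    refine sum_le_sum fun i _ => sum_le_sum fun j _ => sum_le_sum fun k _ => ?_
    split_ifs with h
    · obtain ⟨hm, -⟩ := hgap h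
      have hc : 4 / ((k : ℝ) - i) ≤ 2 := by
        rw [div_le_iff₀ (by linarith)]; linarith
      have hc0 : 0 ≤ 4 / ((k : ℝ) - i) := div_nonneg (by norm_num) (by linarith)
      rw [hmul hm]
      linarith [mul_nonneg hc0 (h0 j k i j),
        mul_le_mul_of_nonneg_right hc (add_nonneg (h0 i j i k) (h0 j k i k))]
    · simp
  · simp only [mul_sum, ← sum_sub_distrib, ← sum_neg_distrib]
    refine sum_le_sum fun i _ => sum_le_sum fun j _ => sum_le_sum fun k _ => ?_
    split_ifs with h
    · obtain ⟨hm, hm'⟩ := hgap h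
      have hc : 1 / ((r : ℝ) + 1) ≤ 1 / ((k : ℝ) - i) :=
        one_div_le_one_div_of_le (by linarith) hm'
      have hc' : 4 / ((k : ℝ) - i) = 4 * (1 / ((k : ℝ) - i)) := by ring
      have hc0 : 0 ≤ 1 / ((k : ℝ) - i) := div_nonneg (by norm_num) (by linarith)
      rw [hmul hm, hc']
      linarith [mul_nonneg hc0 (add_nonneg (h0 i j i k) (h0 j k i k)),
        mul_le_mul_of_nonneg_right hc (h0 j k i j)]
    · simp

lemma diag_sum_bounds (r : ℕ) (N : ℕ × ℕ → ℝ) (h0 : ∀ p, 0 ≤ N p) :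
    0 ≤ ∑ p ∈ Iset r, 2 / ((p.2 : ℝ) - (p.1 : ℝ)) * N p ∧
    ∑ p ∈ Iset r, 2 / ((p.2 : ℝ) - (p.1 : ℝ)) * N p ≤ 2 * ∑ p ∈ Iset r, N p := by
  have hgap {p : ℕ × ℕ} (hp : p ∈ Iset r) : (1 : ℝ) ≤ p.2 - p.1 := by
    have h : p.1 + 1 ≤ p.2 := (mem_filter.1 hp).2.2.1
    have : (p.1 : ℝ) + 1 ≤ p.2 := by exact_mod_cast h
    linarith
  constructor
  · exact sum_nonneg fun p hp =>
      mul_nonneg (div_nonneg (by norm_num) (zero_le_one.trans (hgap hp))) (h0 p)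
  · rw [mul_sum]
    exact sum_le_sum fun p hp =>
      mul_le_mul_of_nonneg_right (div_le_self (by norm_num) (hgap hp)) (h0 p)

/-- Theorem 1.6 (key inequalities): for the Kähler–Einstein metric on the full flag
manifold `SU(r+1)/𝕋`, every symmetric `A` satisfies `2‖A‖² − Q(A) ≥ 0` (nonnegative CQB)
and every nonzero symmetric `A` satisfies `2‖A‖² + Q(A) > 0` (positive ᵈCQB). -/
theorem flag_manifold_cqb (r : ℕ) (hr : 1 ≤ r) (A : ℕ × ℕ → ℕ × ℕ → ℂ)
    (hsym : ∀ α γ : ℕ × ℕ, A α γ = A γ α) :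
    0 ≤ 2 * normSqFlag r A - Qflag r A ∧
    ((∃ α ∈ Iset r, ∃ γ ∈ Iset r, A α γ ≠ 0) → 0 < 2 * normSqFlag r A + Qflag r A) := by
  have h0 (α γ : ℕ × ℕ) : 0 ≤ ‖A α γ‖ ^ 2 := by positivity
  obtain ⟨hD₁, hD₂⟩ := diag_sum_bounds r (fun p => ‖A p p‖ ^ 2) fun p => h0 p p
  obtain ⟨hT₁, hT₂⟩ := triple_sum_bounds r (fun a b c d => ‖A (a, b) (c, d)‖ ^ 2)
    fun a b c d => h0 (a, b) (c, d)
  obtain ⟨hq₁, hq₂⟩ := abs_le.1 (abs_Qflag_quadruple_le r A)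
  have hcount := diag_add_two_mul_le_sum r (fun a b c d => ‖A (a, b) (c, d)‖ ^ 2)
    (fun a b c d => h0 (a, b) (c, d)) (fun a b c d => by rw [hsym (a, b)])
  have hD : 0 ≤ ∑ p ∈ Iset r, ‖A p p‖ ^ 2 := sum_nonneg fun p _ => h0 p p
  have hE : 0 ≤ ∑ i ∈ range (r + 2), ∑ j ∈ range (r + 2), ∑ k ∈ range (r + 2),
      if 1 ≤ i ∧ i < j ∧ j < k ∧ k ≤ r + 1 then
        ‖A (i, j) (i, k)‖ ^ 2 + ‖A (j, k) (i, k)‖ ^ 2 else 0 :=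
    sum_nonneg fun i _ => sum_nonneg fun j _ => sum_nonneg fun k _ => by
      split_ifs <;> positivity
  have hX : 0 ≤ ∑ i ∈ range (r + 2), ∑ j ∈ range (r + 2), ∑ k ∈ range (r + 2),
      if 1 ≤ i ∧ i < j ∧ j < k ∧ k ≤ r + 1 then ‖A (j, k) (i, j)‖ ^ 2 else 0 :=
    sum_nonneg fun i _ => sum_nonneg fun j _ => sum_nonneg fun k _ => by
      split_ifs <;> positivity
  have hY : 0 ≤ ∑ i ∈ range (r + 2), ∑ p ∈ range (r + 2), ∑ q ∈ range (r + 2),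
      ∑ k ∈ range (r + 2), if 1 ≤ i ∧ i < p ∧ p < q ∧ q < k ∧ k ≤ r + 1 then
        ‖A (p, q) (i, k)‖ ^ 2 + ‖A (p, k) (i, q)‖ ^ 2 else 0 :=
    sum_nonneg fun i _ => sum_nonneg fun p _ => sum_nonneg fun q _ => sum_nonneg fun k _ => by
      split_ifs <;> positivity
  have hpos : (∃ α ∈ Iset r, ∃ γ ∈ Iset r, A α γ ≠ 0) →
      0 < ∑ α ∈ Iset r, ∑ γ ∈ Iset r, ‖A α γ‖ ^ 2 := by
    rintro ⟨α, hα, γ, hγ, hne⟩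
    exact sum_pos' (fun α _ => sum_nonneg fun γ _ => h0 α γ)
      ⟨α, hα, sum_pos' (fun γ _ => h0 α γ) ⟨γ, hγ, by positivity⟩⟩
  rw [normSqFlag, Qflag]
  simp only [Prod.mk.eta] at hcount
  generalize (∑ p ∈ Iset r, ‖A p p‖ ^ 2) = D at *
  generalize (∑ α ∈ Iset r, ∑ γ ∈ Iset r, ‖A α γ‖ ^ 2) = n at *
  refine ⟨by linarith, fun hne => ?_⟩
  replace hpos := hpos hne
  have hr' : (1 : ℝ) ≤ r := by exact_mod_cast hr
  have hε : 0 < 1 / ((r : ℝ) + 1) := by positivity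
  have hε' : 1 / ((r : ℝ) + 1) ≤ 1 / 2 := one_div_le_one_div_of_le (by norm_num) (by linarith)
  have key {E X Y : ℝ} (hE : 0 ≤ E) (hX : 0 ≤ X) (hY : 0 ≤ Y)
      (hc : D + 2 * E + 2 * X + 2 * Y ≤ n) :
      0 < 2 * n - 4 * (1 - 1 / ((r : ℝ) + 1)) * X - 2 * Y := by
    generalize 1 / ((r : ℝ) + 1) = ε at *
    have h₁ : (1 - ε) * (2 * X + 2 * Y) ≤ (1 - ε) * n :=
      mul_le_mul_of_nonneg_left (by linarith) (by linarith)
    linarith [mul_pos hε hpos, mul_nonneg (sub_nonneg.2 hε') hY]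
  linarith [key hE hX hY hcount]
end

section
/- Let r ≥ 1. If a symmetric A : I → I → ℂ satisfies A α γ = 0 whenever α ≠ γ or α = (i,k) with k ≠ i+1 (i.e. A is supported on the diagonal entries indexed by the simple roots), then Q(A) = 2·‖A‖². Consequently 2·‖A‖² − Q(A) = 0 for every such A, so the Kähler–Einstein metric on the full flag manifold SU(r+1)/𝕋 has CQB that is nonnegative but not strictly positive. (The sharpness remark following the proof of Theorem 1.6.) -/
open Finset

/-- Sharpness remark after Theorem 1.6: if the symmetric `A` is supported on the diagonal
entries indexed by the simple roots (`A α γ = 0` whenever `α ≠ γ` or `α = (i,k)` with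
`k ≠ i+1`), then `Q(A) = 2‖A‖²`, so `2‖A‖² − Q(A) = 0`: the CQB of the Kähler–Einstein
metric of the full flag manifold is nonnegative but not strictly positive. -/
theorem flag_manifold_cqb_sharp (r : ℕ) (hr : 1 ≤ r) (A : ℕ × ℕ → ℕ × ℕ → ℂ)
    (hsym : ∀ α γ : ℕ × ℕ, A α γ = A γ α)
    (hsupp : ∀ α γ : ℕ × ℕ, (α ≠ γ ∨ α.2 ≠ α.1 + 1) → A α γ = 0) :
    Qflag r A = 2 * normSqFlag r A ∧ 2 * normSqFlag r A - Qflag r A = 0 := by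
  have hdiag : ∑ p ∈ Iset r, (2 / ((p.2 : ℝ) - (p.1 : ℝ))) * ‖A p p‖ ^ 2 =
      2 * normSqFlag r A := by
    rw [normSqFlag, Finset.mul_sum]
    refine Finset.sum_congr rfl fun p hp => ?_
    rw [Finset.sum_eq_single_of_mem p hp fun γ _ hγ => by simp [hsupp p γ (Or.inl hγ.symm)]]
    by_cases h : p.2 = p.1 + 1
    · simp [h]
    · simp [hsupp p p (Or.inr h)]
  have hQ : Qflag r A = 2 * normSqFlag r A := by
    rw [Qflag, hdiag, add_assoc, add_eq_left]
    refine add_eq_zero_iff_eq_neg.mpr ?_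
    rw [Finset.sum_eq_zero fun i _ => Finset.sum_eq_zero fun j _ => Finset.sum_eq_zero fun k _ => ?_,
      Finset.sum_eq_zero fun i _ => Finset.sum_eq_zero fun p _ => Finset.sum_eq_zero fun q _ =>
        Finset.sum_eq_zero fun k _ => ?_, neg_zero]
    · split_ifs with h
      · rw [hsupp (q, k) (i, q) (Or.inl (by simp only [ne_eq, Prod.mk.injEq]; omega)),
          hsupp (p, q) (i, k) (Or.inl (by simp only [ne_eq, Prod.mk.injEq]; omega))]
        simp
      · rfl
    · split_ifs with h
      · rw [hsupp (i, j) (i, k) (Or.inl (by simp only [ne_eq, Prod.mk.injEq]; omega)),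
          hsupp (j, k) (i, k) (Or.inl (by simp only [ne_eq, Prod.mk.injEq]; omega)),
          hsupp (j, k) (i, j) (Or.inl (by simp only [ne_eq, Prod.mk.injEq]; omega))]
        simp
      · rfl
  exact ⟨hQ, sub_eq_zero.mpr hQ.symm⟩
end

section
/- For every nonzero symmetric A : I₆ → I₆ → ℂ (A α γ = A γ α) one has 2·‖A‖² − Q(A) > 0 and 2·‖A‖² + Q(A) > 0. (The key inequalities proving Theorem 1.8: the non-symmetric irreducible Kähler C-space M¹² = SU(6)/S(U(2)×U(2)×U(2)) with b₂ = 2, equipped with its Kähler–Einstein metric, has positive CQB and positive ᵈCQB.) -/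
open Finset

/-- The twelve positive complementary roots of `SU(6)/S(U(2)×U(2)×U(2))`:
`I₆ = {(i,k) : 1 ≤ i < k ≤ 6} \ {(1,2), (3,4), (5,6)}`. -/
def I6 : Finset (ℕ × ℕ) :=
  ((Finset.range 7 ×ˢ Finset.range 7).filter
    (fun p => 1 ≤ p.1 ∧ p.1 < p.2 ∧ p.2 ≤ 6)) \ {(1, 2), (3, 4), (5, 6)}

/-- The components of the Kähler–Einstein metric (Einstein constant `μ = 2`):
`g(i,k) = 4` for `(i,k) ∈ {(1,5),(1,6),(2,5),(2,6)}` and `g(i,k) = 2` for the other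
elements of `I₆`. -/
def g6 (p : ℕ × ℕ) : ℝ := if p.1 ≤ 2 ∧ 5 ≤ p.2 then 4 else 2

/-- `‖A‖² = ∑_{α,γ ∈ I₆} ‖A α γ‖²`. -/
noncomputable def normSq6 (A : ℕ × ℕ → ℕ × ℕ → ℂ) : ℝ :=
  ∑ α ∈ I6, ∑ γ ∈ I6, ‖A α γ‖ ^ 2

/-- The Calabi–Vesentini quadratic form `Q(A)` of the Kähler–Einstein metric on
`SU(6)/S(U(2)×U(2)×U(2))`. -/
noncomputable def Q6 (A : ℕ × ℕ → ℕ × ℕ → ℂ) : ℝ :=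
  (∑ p ∈ I6, (2 / g6 p) * ‖A p p‖ ^ 2) +
  (∑ i ∈ Finset.range 7, ∑ j ∈ Finset.range 7, ∑ k ∈ Finset.range 7,
    if 1 ≤ i ∧ i < j ∧ j < k ∧ k ≤ 6 then
      (4 / g6 (i, k)) *
        ((if (i, j) ∈ I6 then ‖A (i, j) (i, k)‖ ^ 2 else 0) +
         (if (j, k) ∈ I6 then ‖A (j, k) (i, k)‖ ^ 2 else 0) -
         (if (i, j) ∈ I6 ∧ (j, k) ∈ I6 then ‖A (j, k) (i, j)‖ ^ 2 else 0))
    else 0) +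
  (∑ i ∈ Finset.range 7, ∑ p ∈ Finset.range 7, ∑ q ∈ Finset.range 7, ∑ k ∈ Finset.range 7,
    if 1 ≤ i ∧ i < p ∧ p < q ∧ q < k ∧ k ≤ 6 then
      8 * ((if (i, p) ∈ I6 ∧ (p, k) ∈ I6 ∧ (i, q) ∈ I6 ∧ (q, k) ∈ I6 then
              -(((Real.sqrt (g6 (i, p) * g6 (q, k)) /
                  (g6 (i, k) * Real.sqrt (g6 (i, q) * g6 (p, k)))) : ℝ) : ℂ) *
                A (q, k) (i, q) * star (A (p, k) (i, p))
            else 0) +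
           (if (p, q) ∈ I6 ∧ (p, k) ∈ I6 ∧ (i, q) ∈ I6 then
              (((Real.sqrt (g6 (p, q)) /
                  Real.sqrt (g6 (i, k) * g6 (i, q) * g6 (p, k))) : ℝ) : ℂ) *
                A (p, q) (i, k) * star (A (p, k) (i, q))
            else 0)).re
    else 0)

theorem I6_eq : I6 = {(1, 3), (1, 4), (1, 5), (1, 6), (2, 3), (2, 4), (2, 5), (2, 6),
    (3, 5), (3, 6), (4, 5), (4, 6)} := by
  decide

theorem re_ofReal_mul_mul_star_eq_sub (r : ℝ) (x y : ℂ) :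
    ((r : ℂ) * x * star y).re = r * ((‖x‖ ^ 2 + ‖y‖ ^ 2 - ‖x - y‖ ^ 2) / 2) := by
  simp only [Complex.sq_norm, Complex.normSq_apply]
  simp
  ring

theorem re_ofReal_mul_mul_star_eq_add (r : ℝ) (x y : ℂ) :
    ((r : ℂ) * x * star y).re = r * ((‖x + y‖ ^ 2 - ‖x‖ ^ 2 - ‖y‖ ^ 2) / 2) := by
  simp only [Complex.sq_norm, Complex.normSq_apply]
  simp
  ring

theorem re_neg_ofReal_mul_mul_star_eq_sub (r : ℝ) (x y : ℂ) :
    (-(r : ℂ) * x * star y).re = r * ((‖x - y‖ ^ 2 - ‖x‖ ^ 2 - ‖y‖ ^ 2) / 2) := by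
  rw [← Complex.ofReal_neg, re_ofReal_mul_mul_star_eq_sub]
  ring

theorem re_neg_ofReal_mul_mul_star_eq_add (r : ℝ) (x y : ℂ) :
    (-(r : ℂ) * x * star y).re = r * ((‖x‖ ^ 2 + ‖y‖ ^ 2 - ‖x + y‖ ^ 2) / 2) := by
  rw [← Complex.ofReal_neg, re_ofReal_mul_mul_star_eq_add]
  ring

theorem sqrt_two_div_two_mul : √2 / (2 * √2) = (1 / 2 : ℝ) := by
  field_simp

theorem sqrt_two_div_four_mul : √2 / (4 * √2) = (1 / 4 : ℝ) := by
  field_simp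

theorem sqrt_two_div_two_mul_mul_two : √2 / (2 * √2 * 2) = (1 / 4 : ℝ) := by
  field_simp
  norm_num

theorem sqrt_four : √(4 : ℝ) = 2 := by
  rw [show (4 : ℝ) = 2 ^ 2 by norm_num, Real.sqrt_sq zero_le_two]

theorem sum_increasing_triples {M : Type*} [AddCommMonoid M] (f : ℕ → ℕ → ℕ → M) :
    (∑ i ∈ range 7, ∑ j ∈ range 7, ∑ k ∈ range 7,
      if 1 ≤ i ∧ i < j ∧ j < k ∧ k ≤ 6 then f i j k else 0) =
    f 1 2 3 + f 1 2 4 + f 1 2 5 + f 1 2 6 + f 1 3 4 + f 1 3 5 + f 1 3 6 + f 1 4 5 +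
      f 1 4 6 + f 1 5 6 + f 2 3 4 + f 2 3 5 + f 2 3 6 + f 2 4 5 + f 2 4 6 + f 2 5 6 +
      f 3 4 5 + f 3 4 6 + f 3 5 6 + f 4 5 6 := by
  simp [sum_range_succ, add_assoc]

theorem sum_increasing_quadruples {M : Type*} [AddCommMonoid M] (f : ℕ → ℕ → ℕ → ℕ → M) :
    (∑ i ∈ range 7, ∑ p ∈ range 7, ∑ q ∈ range 7, ∑ k ∈ range 7,
      if 1 ≤ i ∧ i < p ∧ p < q ∧ q < k ∧ k ≤ 6 then f i p q k else 0) =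
    f 1 2 3 4 + f 1 2 3 5 + f 1 2 3 6 + f 1 2 4 5 + f 1 2 4 6 + f 1 2 5 6 + f 1 3 4 5 +
      f 1 3 4 6 + f 1 3 5 6 + f 1 4 5 6 + f 2 3 4 5 + f 2 3 4 6 + f 2 3 5 6 + f 2 4 5 6 +
      f 3 4 5 6 := by
  simp [sum_range_succ, add_assoc]

theorem normSq6_pos (A : ℕ × ℕ → ℕ × ℕ → ℂ) (hne : ∃ α ∈ I6, ∃ γ ∈ I6, A α γ ≠ 0) :
    0 < normSq6 A := by
  obtain ⟨α, hα, γ, hγ, h⟩ := hne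
  refine sum_pos' (fun _ _ => sum_nonneg fun _ _ => by positivity) ⟨α, hα, ?_⟩
  exact sum_pos' (fun _ _ => by positivity) ⟨γ, hγ, by positivity⟩

theorem normSq6_sub_Q6_nonneg (A : ℕ × ℕ → ℕ × ℕ → ℂ) (hsym : ∀ α γ : ℕ × ℕ, A α γ = A γ α) :
    0 ≤ normSq6 A - Q6 A := by
  unfold Q6 normSq6
  rw [sum_increasing_triples, sum_increasing_quadruples, I6_eq]
  simp only [Complex.add_re, apply_ite Complex.re, re_ofReal_mul_mul_star_eq_sub,
    re_neg_ofReal_mul_mul_star_eq_add]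
  simp [g6, sqrt_four, sqrt_two_div_two_mul, sqrt_two_div_four_mul,
    sqrt_two_div_two_mul_mul_two, -sub_nonneg]
  simp only [hsym]
  ring_nf
  positivity

theorem normSq6_add_Q6_nonneg (A : ℕ × ℕ → ℕ × ℕ → ℂ) (hsym : ∀ α γ : ℕ × ℕ, A α γ = A γ α) :
    0 ≤ normSq6 A + Q6 A := by
  unfold Q6 normSq6
  rw [sum_increasing_triples, sum_increasing_quadruples, I6_eq]
  simp only [Complex.add_re, apply_ite Complex.re, re_ofReal_mul_mul_star_eq_add,
    re_neg_ofReal_mul_mul_star_eq_sub]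
  simp [g6, sqrt_four, sqrt_two_div_two_mul, sqrt_two_div_four_mul,
    sqrt_two_div_two_mul_mul_two]
  simp only [hsym]
  ring_nf
  positivity

/-- Theorem 1.8 (key inequalities): for the Kähler–Einstein metric on the non-symmetric
irreducible Kähler C-space `M¹² = SU(6)/S(U(2)×U(2)×U(2))` with `b₂ = 2`, every nonzero
symmetric `A` satisfies `2‖A‖² − Q(A) > 0` and `2‖A‖² + Q(A) > 0`: positive CQB and
positive ᵈCQB. -/
theorem su6_space_cqb_pos (A : ℕ × ℕ → ℕ × ℕ → ℂ)
    (hsym : ∀ α γ : ℕ × ℕ, A α γ = A γ α)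
    (hne : ∃ α ∈ I6, ∃ γ ∈ I6, A α γ ≠ 0) :
    0 < 2 * normSq6 A - Q6 A ∧ 0 < 2 * normSq6 A + Q6 A := by
  have hpos := normSq6_pos A hne
  have hsub := normSq6_sub_Q6_nonneg A hsym
  have hadd := normSq6_add_Q6_nonneg A hsym
  constructor <;> linarith
end
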